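/- Let Ω_0 ⊂ (0,1) be an interval with sup Ω_0 = γ* < 1, let (Ω, F, P) = (Ω_0^ℕ, E^ℕ, P) where E is the Borel σ-algebra on Ω_0, and let σ : Ω → Ω be the shift map (σω)_n = ω_{n+1}. For ω ∈ Ω, let T_{1,n}(ω) denote the composition of the Liverani–Saussol–Vaienti maps with parameters ω_1, …, ω_n. Let γ ∈ Ω_0, and assume: (A1) σ preserves P; (A2) (σ, P) is ergodic; (A3) P(ω_1 ≤ γ) > 0. Then for P-almost every ω ∈ Ω: (a) for every probability measure μ on [0,1] with Hölder continuous density and every probability measure ν with density in the cone C_*(γ), |(T_{1,n}(ω))_*(μ − ν)| = O(n^{−1/γ + 1}); and (b) for any two probability measures μ, μ' on [0,1] with Hölder continuous densities, |(T_{1,n}(ω))_*(μ − μ')| = O(n^{−1/γ}). -/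

import Mathlib

open MeasureTheory Set Filter
open scoped NNReal ENNReal

noncomputable section

/-- `seqComp T k n = T (k+n-1) ∘ ⋯ ∘ T (k+1) ∘ T k`. -/
def seqComp {α : Type*} (T : ℕ → α → α) (k : ℕ) : ℕ → α → α
  | 0 => id
  | n + 1 => fun x => T (k + n) (seqComp T k n x)

/-- The Liverani–Saussol–Vaienti map with parameter `γ`. -/
def lsv (γ : ℝ) (x : ℝ) : ℝ :=
  if x < 1 / 2 then x * (1 + 2 ^ γ * x ^ γ) else 2 * (x - 1 / 2)

/-- Total variation distance between two (finite) measures. -/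
def tvDist {α : Type*} [MeasurableSpace α] (μ ν : Measure α) : ℝ :=
  ⨆ s : { s : Set α // MeasurableSet s }, |(μ s.1).toReal - (ν s.1).toReal|

/-- `μ` is a measure on `s ⊆ ℝ` with a Hölder continuous density w.r.t. Lebesgue measure. -/
def HolderDensityOn (s : Set ℝ) (μ : Measure ℝ) : Prop :=
  ∃ f : ℝ → ℝ, (∀ x, 0 ≤ f x) ∧
    (∃ C r : ℝ≥0, 0 < r ∧ r ≤ 1 ∧ HolderOnWith C r f s) ∧
    μ = (volume.restrict s).withDensity fun x => ENNReal.ofReal (f x)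

/-- Membership in the cone `C_*(β)` (with constant `aβ`). -/
def memConeStar (β aβ : ℝ) (f : ℝ → ℝ) : Prop :=
  ContinuousOn f (Ioc 0 1) ∧ IntegrableOn f (Ioc 0 1) ∧
  (∀ x ∈ Ioc (0:ℝ) 1, 0 ≤ f x) ∧ AntitoneOn f (Ioc 0 1) ∧
  MonotoneOn (fun x => x ^ (β + 1) * f x) (Ioc 0 1) ∧
  ∀ x ∈ Ioc (0:ℝ) 1, f x ≤ aβ * x ^ (-β) * ∫ t in Ioc (0:ℝ) 1, f t

/-- `ν` is a measure on `[0,1]` whose density lies in the cone `C_*(β)`. -/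
def ConeDensity (β aβ : ℝ) (ν : Measure ℝ) : Prop :=
  ∃ f : ℝ → ℝ, memConeStar β aβ f ∧
    ν = (volume.restrict (Icc (0:ℝ) 1)).withDensity fun x => ENNReal.ofReal (f x)

/-- The left shift on sequences. -/
def shift (ω : ℕ → ℝ) : ℕ → ℝ := fun n => ω (n + 1)

/-- `T_{1,n}(ω)`: the composition of LSV maps with the parameters `ω 0, …, ω (n-1)`
(in the paper's 1-based notation, `ω_1, …, ω_n`). -/
def lsvComp (ω : ℕ → ℝ) (n : ℕ) : ℝ → ℝ := seqComp (fun i => lsv (ω i)) 0 n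

/-- Running maximum of the Birkhoff sums of `g`, including the empty sum. -/
def birkhoffMax {α : Type*} (T : α → α) (g : α → ℝ) : ℕ → α → ℝ
  | 0 => fun _ => 0
  | n + 1 => fun x => max 0 (g x + birkhoffMax T g n (T x))

lemma birkhoffSum_le_birkhoffMax {α : Type*} (T : α → α) (g : α → ℝ) (n : ℕ) (x : α) :
    birkhoffSum T g n x ≤ birkhoffMax T g n x := by
  induction n generalizing x with
  | zero => simp [birkhoffMax]
  | succ n ih =>
    rw [birkhoffSum_succ']
    exact le_max_of_le_right (by linarith [ih (T x)])

lemma birkhoffMax_nonneg {α : Type*} (T : α → α) (g : α → ℝ) (n : ℕ) (x : α) :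
    0 ≤ birkhoffMax T g n x := by
  cases n with
  | zero => simp [birkhoffMax]
  | succ n => exact le_max_left _ _

lemma birkhoffMax_monotone {α : Type*} (T : α → α) (g : α → ℝ) (x : α) :
    Monotone fun n => birkhoffMax T g n x := by
  refine monotone_nat_of_le_succ fun n => ?_
  induction n generalizing x with
  | zero => exact birkhoffMax_nonneg T g 1 x
  | succ n ih => exact max_le_max le_rfl (by linarith [ih (T x)])

lemma birkhoffMax_le {α : Type*} {T : α → α} {g : α → ℝ} (hb : ∀ x, |g x| ≤ 1) (n : ℕ) (x : α) :
    birkhoffMax T g n x ≤ n := by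
  induction n generalizing x with
  | zero => simp [birkhoffMax]
  | succ n ih =>
    have := ih (T x)
    have := (abs_le.1 (hb x)).2
    push_cast
    exact max_le (by positivity) (by linarith)

lemma measurable_birkhoffMax {α : Type*} [MeasurableSpace α] {T : α → α} {g : α → ℝ}
    (hT : Measurable T) (hg : Measurable g) (n : ℕ) : Measurable (birkhoffMax T g n) := by
  induction n with
  | zero => exact measurable_const
  | succ n ih => exact measurable_const.max (hg.add (ih.comp hT))

/-- If `g` is bounded with negative mean, its Birkhoff sums over an ergodic system are almost
surely bounded above. -/
theorem Ergodic.ae_bddAbove_birkhoffSum {α : Type*} [MeasurableSpace α] {μ : Measure α}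
    [IsProbabilityMeasure μ] {T : α → α} (hT : Ergodic T μ) {g : α → ℝ} (hg : Measurable g)
    (hb : ∀ x, |g x| ≤ 1) (hneg : ∫ x, g x ∂μ < 0) :
    ∀ᵐ x ∂μ, BddAbove (range fun n => birkhoffSum T g n x) := by
  set M := birkhoffMax T g with hM
  have hMm : ∀ n, Measurable (M n) := measurable_birkhoffMax hT.measurable hg
  have hMint : ∀ n, Integrable (M n) μ := fun n =>
    Integrable.of_bound (hMm n).aestronglyMeasurable n <| .of_forall fun x => by
      rw [Real.norm_eq_abs, abs_of_nonneg (birkhoffMax_nonneg T g n x)]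
      exact birkhoffMax_le hb n x
  let S : Set α := {x | BddAbove (range fun n => M n x)}
  have hS : MeasurableSet S := measurableSet_bddAbove_range hMm
  have hSinv : T ⁻¹' S = S := by
    ext x
    constructor
    · rintro ⟨C, hC⟩
      refine ⟨max 0 (g x + C), ?_⟩
      rintro _ ⟨n, rfl⟩
      cases n with
      | zero => exact le_max_left _ _
      | succ n => exact max_le_max le_rfl (by linarith [hC ⟨n, rfl⟩])
    · rintro ⟨C, hC⟩
      refine ⟨C - g x, ?_⟩
      rintro _ ⟨n, rfl⟩
      have h1 : M (n + 1) x ≤ C := hC ⟨n + 1, rfl⟩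
      have h2 : g x + M n (T x) ≤ M (n + 1) x := le_max_right _ _
      simp only; linarith
  rcases hT.toPreErgodic.ae_mem_or_ae_notMem hS hSinv with h | h
  · filter_upwards [h] with x hx
    obtain ⟨C, hC⟩ := hx
    refine ⟨C, ?_⟩
    rintro _ ⟨n, rfl⟩
    exact (birkhoffSum_le_birkhoffMax T g n x).trans (hC ⟨n, rfl⟩)
  · exfalso
    have hpos : ∀ n, 0 ≤ ∫ x, (M (n + 1) x - M n (T x)) ∂μ := fun n => by
      have hc : ∫ x, M n (T x) ∂μ = ∫ x, M n x ∂μ := by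
        have := integral_map (μ := μ) hT.measurable.aemeasurable (f := M n)
          (by rw [hT.map_eq]; exact (hMm n).aestronglyMeasurable)
        rw [hT.map_eq] at this
        exact this.symm
      have hi : Integrable (fun x => M n (T x)) μ :=
        hT.toMeasurePreserving.integrable_comp_of_integrable (hMint n)
      rw [integral_sub (hMint _) hi, hc, sub_nonneg]
      exact integral_mono (hMint n) (hMint _) fun x => birkhoffMax_monotone T g x n.le_succ
    have hlim : Tendsto (fun n => ∫ x, (M (n + 1) x - M n (T x)) ∂μ) atTop
        (nhds (∫ x, g x ∂μ)) := by
      refine tendsto_integral_of_dominated_convergence (fun _ => 1)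
        (fun n => ((hMm _).sub ((hMm n).comp hT.measurable)).aestronglyMeasurable)
        (integrable_const _) (fun n => .of_forall fun x => ?_) ?_
      · have h0 := birkhoffMax_nonneg T g n (T x)
        have := abs_le.1 (hb x)
        simp only [hM, birkhoffMax, Real.norm_eq_abs, abs_le]
        rcases le_total 0 (g x + birkhoffMax T g n (T x)) with h | h
        · rw [max_eq_right h]; constructor <;> linarith
        · rw [max_eq_left h]; constructor <;> linarith
      · filter_upwards [h] with x hx
        have hx' : T x ∉ S := fun hTx => hx (by rwa [← hSinv])
        have hx'' : ∃ n, 1 < M n (T x) := by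
          by_contra! hcon
          exact hx' ⟨1, by rintro _ ⟨n, rfl⟩; exact hcon n⟩
        obtain ⟨n, hn⟩ := hx''
        refine tendsto_const_nhds.congr' ?_
        filter_upwards [eventually_ge_atTop n] with m hm
        have h1 : M n (T x) ≤ M m (T x) := birkhoffMax_monotone T g (T x) hm
        have h2 := (abs_le.1 (hb x)).1
        have h3 : M (m + 1) x = max 0 (g x + M m (T x)) := rfl
        rw [h3, max_eq_right (by linarith)]
        ring
    exact absurd (ge_of_tendsto' hlim hpos) (not_le.2 hneg)

/-- The frequency of visits to a set of positive measure is bounded below along almost every orbit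
of an ergodic system. -/
theorem Ergodic.ae_le_card_visits {α : Type*} [MeasurableSpace α] {μ : Measure α}
    [IsProbabilityMeasure μ] {T : α → α} (hT : Ergodic T μ) {E : Set α} (hE : MeasurableSet E)
    (hpos : 0 < μ E) :
    ∃ c : ℝ, 0 < c ∧ ∀ᵐ x ∂μ, ∃ C : ℝ, ∀ n : ℕ,
      c * n - C ≤ birkhoffSum T (E.indicator fun _ => (1 : ℝ)) n x := by
  have hp : 0 < μ.real E := ENNReal.toReal_pos hpos.ne' (measure_ne_top _ _)
  have hp1 : μ.real E ≤ 1 := measureReal_le_one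
  refine ⟨μ.real E / 2, by positivity, ?_⟩
  set φ : α → ℝ := E.indicator fun _ => (1 : ℝ)
  have hφm : Measurable φ := measurable_const.indicator hE
  have hφ : ∀ x, 0 ≤ φ x ∧ φ x ≤ 1 := fun x =>
    ⟨indicator_nonneg (fun _ _ => zero_le_one) x, indicator_le_self' (fun _ _ => zero_le_one) x⟩
  have hφi : Integrable φ μ := (integrable_const _).indicator hE
  have hint : ∫ x, (μ.real E / 2 - φ x) ∂μ < 0 := by
    rw [integral_sub (integrable_const _) hφi]
    have : ∫ x, φ x ∂μ = μ.real E := by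
      simp only [φ]; rw [integral_indicator hE]; simp
    rw [this]; simp; linarith
  filter_upwards [hT.ae_bddAbove_birkhoffSum (g := fun x => μ.real E / 2 - φ x)
    (measurable_const.sub hφm) (fun x => by
      rw [abs_le]; constructor <;> linarith [(hφ x).1, (hφ x).2]) hint] with x hx
  obtain ⟨C, hC⟩ := hx
  refine ⟨C, fun n => ?_⟩
  have h := hC ⟨n, rfl⟩
  simp only [birkhoffSum, Finset.sum_sub_distrib, Finset.sum_const, Finset.card_range,
    nsmul_eq_mul] at h ⊢
  linarith

/-- `iterStep A t k = A (t+k-1) ∘ ⋯ ∘ A t`. -/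
def iterStep {V : Type*} (A : ℕ → V → V) (t : ℕ) : ℕ → V → V
  | 0 => id
  | k + 1 => fun f => A (t + k) (iterStep A t k f)

lemma iterStep_succ' {V : Type*} (A : ℕ → V → V) (t k : ℕ) (f : V) :
    iterStep A t (k + 1) f = iterStep A (t + 1) k (A t f) := by
  induction k with
  | zero => rfl
  | succ k ih =>
    change A (t + (k + 1)) (iterStep A t (k + 1) f) = A (t + 1 + k) _
    rw [ih]; congr 1; omega

/-- A nonautonomous transfer operator `A t + B` on densities, where `B` is the part landing in the
regular class: mass flowing through `B` is renewed, mass flowing through `A t` is still waiting.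
`W` is the cone of admissible densities, `D` and `D'` are two nested classes of regular ones,
`ε` is the Doeblin constant of `D'` and `β t k` bounds the proportion of a density in `D` at
time `t` that waits at least `k` steps. -/
structure TransferScheme (V : Type*) [AddCommGroup V] [Module ℝ V] where
  W : Set V
  D : Set V
  D' : Set V
  A : ℕ → V → V
  B : V → V
  mass : V → ℝ
  ε : ℝ
  β : ℕ → ℕ → ℝ
  D_subset : D ⊆ W
  D'_subset : D' ⊆ D
  A_mem : ∀ t f, f ∈ W → A t f ∈ W
  B_mem : ∀ f, f ∈ W → B f ∈ D'
  add_mem : ∀ f g, f ∈ W → g ∈ W → f + g ∈ W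
  A_add : ∀ t f g, A t (f + g) = A t f + A t g
  mass_nonneg : ∀ f, f ∈ W → 0 ≤ mass f
  mass_add : ∀ f g, f ∈ W → g ∈ W → mass (f + g) = mass f + mass g
  mass_split : ∀ t f, f ∈ W → mass f = mass (A t f) + mass (B f)
  ε_pos : 0 < ε
  ε_lt_one : ε < 1
  doeblin : ∀ f g, f ∈ D' → g ∈ D' → ∃ G₀ ∈ D, ∃ G₁ ∈ D, ∃ u ∈ W,
    mass g • f = G₀ + u ∧ mass f • g = G₁ + u ∧
    mass G₀ = (1 - ε) * (mass f * mass g) ∧ mass G₁ = (1 - ε) * (mass f * mass g)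
  lower : ∀ k, ∃ C, 0 < C ∧ ∀ t f, f ∈ W → mass f ≤ C * mass (B f) + mass (iterStep A t k f)
  β_nonneg : ∀ t k, 0 ≤ β t k
  tail : ∀ t k f, f ∈ D → mass (iterStep A t k f) ≤ β t k * mass f

namespace TransferScheme
variable {V : Type*} [AddCommGroup V] [Module ℝ V] (𝒯 : TransferScheme V)

/-- The family of expectations, seen from the times `t ≤ N`, of a fixed `[0,1]`-valued observable
at time `N`. -/
structure Observable (N : ℕ) where
  e : ℕ → V → ℝ
  nonneg : ∀ t f, f ∈ 𝒯.W → 0 ≤ e t f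
  le_mass : ∀ t f, f ∈ 𝒯.W → e t f ≤ 𝒯.mass f
  add : ∀ t f g, f ∈ 𝒯.W → g ∈ 𝒯.W → e t (f + g) = e t f + e t g
  smul : ∀ t (c : ℝ) f, e t (c • f) = c * e t f
  split : ∀ t f, t < N → f ∈ 𝒯.W → e t f = e (t + 1) (𝒯.A t f) + e (t + 1) (𝒯.B f)

/-- The part of `f` that waits `m` steps from time `s` and is then renewed. -/
def piece (s m : ℕ) (f : V) : V := 𝒯.B (iterStep 𝒯.A s m f)

/-- The evolution of `f` from time `t` to time `t + n` under the full transfer operator. -/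
def evol (t : ℕ) : ℕ → V → V
  | 0 => id
  | n + 1 => fun f => 𝒯.A (t + n) (evol t n f) + 𝒯.B (evol t n f)

variable {𝒯}

lemma D'_subset_W {f : V} (hf : f ∈ 𝒯.D') : f ∈ 𝒯.W := 𝒯.D_subset (𝒯.D'_subset hf)

lemma iterStep_mem (s k : ℕ) {f : V} (hf : f ∈ 𝒯.W) : iterStep 𝒯.A s k f ∈ 𝒯.W := by
  induction k with
  | zero => exact hf
  | succ k ih => exact 𝒯.A_mem _ _ ih

lemma iterStep_add (s k : ℕ) (f g : V) :
    iterStep 𝒯.A s k (f + g) = iterStep 𝒯.A s k f + iterStep 𝒯.A s k g := by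
  induction k with
  | zero => rfl
  | succ k ih => simp only [iterStep, ih, 𝒯.A_add]

lemma piece_mem (s m : ℕ) {f : V} (hf : f ∈ 𝒯.W) : 𝒯.piece s m f ∈ 𝒯.D' :=
  𝒯.B_mem _ (iterStep_mem s m hf)

lemma mass_piece_nonneg (s m : ℕ) {f : V} (hf : f ∈ 𝒯.W) : 0 ≤ 𝒯.mass (𝒯.piece s m f) :=
  𝒯.mass_nonneg _ (D'_subset_W (piece_mem s m hf))

lemma mass_piece (s m : ℕ) {f : V} (hf : f ∈ 𝒯.W) : 𝒯.mass (𝒯.piece s m f) =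
    𝒯.mass (iterStep 𝒯.A s m f) - 𝒯.mass (iterStep 𝒯.A s (m + 1) f) := by
  have := 𝒯.mass_split (s + m) _ (iterStep_mem s m hf)
  simp only [piece, iterStep] at this ⊢
  linarith

lemma mass_eq_sum_piece (s J : ℕ) {f : V} (hf : f ∈ 𝒯.W) : 𝒯.mass f =
    ∑ m ∈ Finset.range J, 𝒯.mass (𝒯.piece s m f) + 𝒯.mass (iterStep 𝒯.A s J f) := by
  induction J with
  | zero => simp [iterStep]
  | succ J ih => rw [Finset.sum_range_succ, mass_piece s J hf]; linarith

lemma sum_mul_mass_piece_le (s J : ℕ) {f : V} (hf : f ∈ 𝒯.W) :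
    ∑ m ∈ Finset.range J, (m : ℝ) * 𝒯.mass (𝒯.piece s m f) ≤
      ∑ k ∈ Finset.range J, 𝒯.mass (iterStep 𝒯.A s (k + 1) f) := by
  have h : ∑ m ∈ Finset.range J, (m : ℝ) * 𝒯.mass (𝒯.piece s m f) +
      J * 𝒯.mass (iterStep 𝒯.A s J f) =
      ∑ k ∈ Finset.range J, 𝒯.mass (iterStep 𝒯.A s (k + 1) f) := by
    induction J with
    | zero => simp
    | succ J ih =>
      rw [Finset.sum_range_succ, Finset.sum_range_succ, mass_piece s J hf, ← ih]
      push_cast; ring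
  have := mul_nonneg J.cast_nonneg (𝒯.mass_nonneg _ (iterStep_mem s J hf)) (α := ℝ)
  linarith

lemma evol_mem (t n : ℕ) {f : V} (hf : f ∈ 𝒯.W) : 𝒯.evol t n f ∈ 𝒯.W := by
  induction n with
  | zero => exact hf
  | succ n ih => exact 𝒯.add_mem _ _ (𝒯.A_mem _ _ ih) (D'_subset_W (𝒯.B_mem _ ih))

lemma mass_evol (t n : ℕ) {f : V} (hf : f ∈ 𝒯.W) : 𝒯.mass (𝒯.evol t n f) = 𝒯.mass f := by
  induction n with
  | zero => rfl
  | succ n ih =>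
    have h := evol_mem t n hf
    rw [← ih, 𝒯.mass_split (t + n) _ h]
    exact 𝒯.mass_add _ _ (𝒯.A_mem _ _ h) (D'_subset_W (𝒯.B_mem _ h))

lemma mass_iterStep_evol_le (t n k : ℕ) {f : V} (hf : f ∈ 𝒯.D) :
    𝒯.mass (iterStep 𝒯.A (t + n) k (𝒯.evol t n f)) ≤
      (∑ i ∈ Finset.range (n + 1), 𝒯.β (t + i) (k + (n - i))) * 𝒯.mass f := by
  induction n generalizing k with
  | zero => simpa [evol] using 𝒯.tail t k f hf
  | succ n ih =>
    have hW := evol_mem t n (𝒯.D_subset hf)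
    have hB := 𝒯.B_mem _ hW
    change 𝒯.mass (iterStep 𝒯.A (t + n + 1) k
      (𝒯.A (t + n) (𝒯.evol t n f) + 𝒯.B (𝒯.evol t n f))) ≤ _
    rw [iterStep_add, 𝒯.mass_add _ _ (iterStep_mem _ _ (𝒯.A_mem _ _ hW))
      (iterStep_mem _ _ (D'_subset_W hB)), ← iterStep_succ', Finset.sum_range_succ, add_mul]
    refine add_le_add ((ih (k + 1)).trans_eq ?_) ?_
    · congr 1
      refine Finset.sum_congr rfl fun i hi => ?_
      have := Finset.mem_range.1 hi
      congr 1; omega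
    · refine (𝒯.tail _ _ _ (𝒯.D'_subset hB)).trans ?_
      simp only [Nat.sub_self, add_zero]
      refine mul_le_mul_of_nonneg_left ?_ (𝒯.β_nonneg _ _)
      have h1 := 𝒯.mass_split (t + n) _ hW
      have h2 := 𝒯.mass_nonneg _ (𝒯.A_mem (t + n) _ hW)
      have h3 := mass_evol t n (𝒯.D_subset hf)
      linarith

namespace Observable
variable {N : ℕ} (𝒪 : 𝒯.Observable N)

lemma eq_sum_piece (s J : ℕ) {f : V} (hf : f ∈ 𝒯.W) (hJ : s + J ≤ N) : 𝒪.e s f =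
    ∑ m ∈ Finset.range J, 𝒪.e (s + 1 + m) (𝒯.piece s m f) +
      𝒪.e (s + J) (iterStep 𝒯.A s J f) := by
  induction J with
  | zero => simp [iterStep]
  | succ J ih =>
    rw [Finset.sum_range_succ, ih (by omega), 𝒪.split (s + J) _ (by omega) (iterStep_mem s J hf)]
    simp only [piece, iterStep]
    rw [show s + 1 + J = s + J + 1 by ring, show s + (J + 1) = s + J + 1 by ring]
    ring

lemma eq_evol (t n : ℕ) {f : V} (hf : f ∈ 𝒯.W) (hn : t + n ≤ N) :
    𝒪.e t f = 𝒪.e (t + n) (𝒯.evol t n f) := by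
  induction n with
  | zero => rfl
  | succ n ih =>
    have h := evol_mem t n hf
    rw [ih (by omega), 𝒪.split (t + n) _ (by omega) h]
    exact (𝒪.add _ _ _ (𝒯.A_mem _ _ h) (D'_subset_W (𝒯.B_mem _ h))).symm

/-- Comparing `f` at time `s` with `H` at time `σ` by comparing each renewed piece of `f` with
`H`. -/
lemma abs_sub_le_of_piece (s σ J : ℕ) {f H : V} (hf : f ∈ 𝒯.W) (hH : H ∈ 𝒯.W) (hJ : s + J ≤ N)
    (X : ℕ → ℝ) (hX : ∀ m < J,
      |𝒯.mass H * 𝒪.e (s + 1 + m) (𝒯.piece s m f) - 𝒯.mass (𝒯.piece s m f) * 𝒪.e σ H| ≤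
        X m * (𝒯.mass H * 𝒯.mass (𝒯.piece s m f))) :
    |𝒯.mass H * 𝒪.e s f - 𝒯.mass f * 𝒪.e σ H| ≤
      𝒯.mass H * (∑ m ∈ Finset.range J, X m * 𝒯.mass (𝒯.piece s m f) +
        𝒯.mass (iterStep 𝒯.A s J f)) := by
  set R := iterStep 𝒯.A s J f with hR
  have hRW : R ∈ 𝒯.W := iterStep_mem s J hf
  have key : 𝒯.mass H * 𝒪.e s f - 𝒯.mass f * 𝒪.e σ H =
      ∑ m ∈ Finset.range J, (𝒯.mass H * 𝒪.e (s + 1 + m) (𝒯.piece s m f) -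
        𝒯.mass (𝒯.piece s m f) * 𝒪.e σ H) +
      (𝒯.mass H * 𝒪.e (s + J) R - 𝒯.mass R * 𝒪.e σ H) := by
    rw [𝒪.eq_sum_piece s J hf hJ, mass_eq_sum_piece s J hf, Finset.sum_sub_distrib,
      ← Finset.mul_sum, ← Finset.sum_mul]
    ring
  have hrest : |𝒯.mass H * 𝒪.e (s + J) R - 𝒯.mass R * 𝒪.e σ H| ≤ 𝒯.mass H * 𝒯.mass R := by
    have hH0 := 𝒯.mass_nonneg _ hH
    have hR0 := 𝒯.mass_nonneg _ hRW
    have h1 := mul_nonneg hH0 (𝒪.nonneg (s + J) _ hRW)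
    have h2 := mul_le_mul_of_nonneg_left (𝒪.le_mass (s + J) _ hRW) hH0
    have h3 := mul_nonneg hR0 (𝒪.nonneg σ _ hH)
    have h4 := mul_le_mul_of_nonneg_left (𝒪.le_mass σ _ hH) hR0
    rw [abs_le]; constructor <;> nlinarith
  rw [key, mul_add, Finset.mul_sum]
  refine (abs_add_le _ _).trans (add_le_add ((Finset.abs_sum_le_sum_abs _ _).trans
    (Finset.sum_le_sum fun m hm => (hX m (Finset.mem_range.1 hm)).trans_eq (by ring))) hrest)

end Observable

/-- Renewal happens with uniformly positive probability at every time. -/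
lemma exists_le_mass_B_evol {b : ℕ → ℝ} (hb : Summable b) (hβ : ∀ t k, 𝒯.β t k ≤ b k) :
    ∃ c : ℝ, 0 < c ∧ ∀ t n, ∀ f ∈ 𝒯.D, c * 𝒯.mass f ≤ 𝒯.mass (𝒯.B (𝒯.evol t n f)) := by
  have hb0 : ∀ k, 0 ≤ b k := fun k => (𝒯.β_nonneg 0 k).trans (hβ 0 k)
  have hlim := tendsto_sum_nat_add b
  obtain ⟨k, hk⟩ := ((tendsto_order.1 hlim).2 (1 / 2) (by norm_num)).exists
  obtain ⟨C, hC, hCk⟩ := 𝒯.lower k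
  refine ⟨1 / (2 * C), by positivity, fun t n f hf => ?_⟩
  have h1 := hCk (t + n) _ (evol_mem t n (𝒯.D_subset hf))
  rw [mass_evol t n (𝒯.D_subset hf)] at h1
  have h2 := mass_iterStep_evol_le t n k hf
  have h3 : ∑ i ∈ Finset.range (n + 1), 𝒯.β (t + i) (k + (n - i)) ≤ 1 / 2 := by
    have hr := Finset.sum_range_reflect (fun j => b (j + k)) (n + 1)
    calc _ ≤ ∑ i ∈ Finset.range (n + 1), b (n + 1 - 1 - i + k) :=
          Finset.sum_le_sum fun i _ => (hβ _ _).trans_eq (by congr 1; omega)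
      _ = ∑ i ∈ Finset.range (n + 1), b (i + k) := hr
      _ ≤ ∑' i, b (i + k) :=
          ((summable_nat_add_iff k).2 hb).sum_le_tsum _ (fun i _ => hb0 _)
      _ ≤ 1 / 2 := hk.le
  have h4 := 𝒯.mass_nonneg _ (𝒯.D_subset hf)
  have h5 := mul_le_mul_of_nonneg_right h3 h4
  rw [div_mul_eq_mul_div, div_le_iff₀ (by positivity)]
  linarith

end TransferScheme

/-- Double tail sums of a summable sequence grow sublinearly. -/
lemma exists_sum_sum_le {b : ℕ → ℝ} (hb : Summable b) (hb0 : ∀ k, 0 ≤ b k) :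
    ∃ C : ℝ, 0 ≤ C ∧ ∀ n J : ℕ, ∑ k ∈ Finset.range J, ∑ i ∈ Finset.range (n + 1),
      b (k + 1 + (n - i)) ≤ C + (n + 1) / 4 := by
  obtain ⟨k₀, hk₀⟩ := (eventually_atTop.1
    ((tendsto_order.1 (tendsto_sum_nat_add b)).2 (1 / 4) (by norm_num)))
  refine ⟨k₀ * ∑' k, b k, mul_nonneg k₀.cast_nonneg (tsum_nonneg hb0), fun n J => ?_⟩
  have hrow : ∀ l, ∑ k ∈ Finset.range J, b (k + 1 + l) ≤
      (if l < k₀ then ∑' k, b k else 0) + 1 / 4 := fun l => by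
    have h1 : ∑ k ∈ Finset.range J, b (k + 1 + l) ≤ ∑' k, b (k + (1 + l)) := by
      simp_rw [add_assoc]
      exact ((summable_nat_add_iff _).2 hb).sum_le_tsum _ (fun i _ => hb0 _)
    split_ifs with h
    · have := hb.sum_add_tsum_nat_add (1 + l)
      have h2 : 0 ≤ ∑ i ∈ Finset.range (1 + l), b i := Finset.sum_nonneg fun i _ => hb0 i
      linarith
    · have := hk₀ (1 + l) (by omega)
      linarith
  rw [Finset.sum_comm]
  calc _ ≤ ∑ i ∈ Finset.range (n + 1),
        ((if n + 1 - 1 - i < k₀ then ∑' k, b k else 0) + 1 / 4) :=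
        Finset.sum_le_sum fun i _ => hrow _
    _ = ∑ l ∈ Finset.range (n + 1), ((if l < k₀ then ∑' k, b k else 0) + 1 / 4) :=
        Finset.sum_range_reflect (fun l => (if l < k₀ then ∑' k, b k else 0) + 1 / 4) (n + 1)
    _ ≤ _ := by
        rw [Finset.sum_add_distrib, ← Finset.sum_filter, Finset.sum_const, Finset.sum_const]
        simp only [nsmul_eq_mul, Finset.card_range]
        push_cast
        have hcard : (((Finset.range (n + 1)).filter (· < k₀)).card : ℝ) ≤ k₀ := by
          have : ((Finset.range (n + 1)).filter (· < k₀)).card ≤ (Finset.range k₀).card :=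
            Finset.card_le_card fun x hx => by
              simp at hx ⊢; exact hx.2
          simpa using (Nat.cast_le (α := ℝ)).2 this
        have hsum : 0 ≤ ∑' k, b k := tsum_nonneg hb0
        have := mul_le_mul_of_nonneg_right hcard hsum
        linarith

namespace TransferScheme
variable {V : Type*} [AddCommGroup V] [Module ℝ V] {𝒯 : TransferScheme V}

/-- The waiting-time bounds: a summable bound `b` in real time, and a polynomial bound in the
internal time `S`. -/
structure TailBounds (𝒯 : TransferScheme V) (S : ℕ → ℝ) (α : ℝ) (b : ℕ → ℝ) (Ct : ℝ) : Prop where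
  α_pos : 0 < α
  Ct_nonneg : 0 ≤ Ct
  mono : Monotone S
  step : ∀ k, S (k + 1) ≤ S k + 1
  summable : Summable b
  le_b : ∀ t k, 𝒯.β t k ≤ b k
  le_rpow : ∀ t k, 𝒯.β t k ≤ Ct * (1 + (S (t + k) - S t)) ^ (-α)

/-- Memory loss between a density at time `t` and one at time `t' > t`, at the rate prescribed by
`K`, `A`, `η`. -/
def GapBound (𝒯 : TransferScheme V) (S : ℕ → ℝ) (α K A η : ℝ) (N t' : ℕ) (𝒪 : 𝒯.Observable N) :
    Prop :=
  ∀ t < t', ∀ G ∈ 𝒯.D, ∀ F ∈ 𝒯.D', 0 < S N - S t → S t' - S t < η * (S N - S t) →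
    |𝒯.mass G * 𝒪.e t' F - 𝒯.mass F * 𝒪.e t G| ≤
      K * ((t' - t : ℕ) + A) * (S N - S t) ^ (-α) * (𝒯.mass G * 𝒯.mass F)

variable {S : ℕ → ℝ} {α Ct : ℝ} {b : ℕ → ℝ}

/-- Two densities in `D'` at the same time, using the Doeblin decomposition. -/
lemma abs_sub_le_of_doeblin {Y : ℝ} {N t : ℕ} (𝒪 : 𝒯.Observable N)
    (hY : ∀ G₀ ∈ 𝒯.D, ∀ G₁ ∈ 𝒯.D, |𝒯.mass G₀ * 𝒪.e t G₁ - 𝒯.mass G₁ * 𝒪.e t G₀| ≤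
      Y * (𝒯.mass G₀ * 𝒯.mass G₁)) {f g : V} (hf : f ∈ 𝒯.D') (hg : g ∈ 𝒯.D') :
    |𝒯.mass g * 𝒪.e t f - 𝒯.mass f * 𝒪.e t g| ≤
      (1 - 𝒯.ε) * Y * (𝒯.mass g * 𝒯.mass f) := by
  obtain ⟨G₀, h₀, G₁, h₁, u, hu, hf', hg', hm₀, hm₁⟩ := 𝒯.doeblin f g hf hg
  have e₀ := 𝒪.add t _ _ (𝒯.D_subset h₀) hu
  have e₁ := 𝒪.add t _ _ (𝒯.D_subset h₁) hu
  rw [← hf', 𝒪.smul] at e₀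
  rw [← hg', 𝒪.smul] at e₁
  have hY' := hY _ h₁ _ h₀
  rw [e₀, e₁, add_sub_add_right_eq_sub]
  set v := (1 - 𝒯.ε) * (𝒯.mass f * 𝒯.mass g)
  rw [hm₀, hm₁, ← mul_sub, abs_mul] at hY'
  have hv0 : 0 ≤ v := mul_nonneg (sub_nonneg.2 𝒯.ε_lt_one.le)
    (mul_nonneg (𝒯.mass_nonneg _ (D'_subset_W hf)) (𝒯.mass_nonneg _ (D'_subset_W hg)))
  rcases hv0.eq_or_lt with hv | hv
  · have b0 := 𝒪.nonneg t _ (𝒯.D_subset h₀)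
    have b1 := 𝒪.le_mass t _ (𝒯.D_subset h₀)
    have b2 := 𝒪.nonneg t _ (𝒯.D_subset h₁)
    have b3 := 𝒪.le_mass t _ (𝒯.D_subset h₁)
    rw [hm₀, ← hv] at b1
    rw [hm₁, ← hv] at b3
    have z0 : 𝒪.e t G₀ = 0 := le_antisymm b1 b0
    have z1 : 𝒪.e t G₁ = 0 := le_antisymm b3 b2
    rw [z0, z1, sub_zero, abs_zero]
    have : (1 - 𝒯.ε) * Y * (𝒯.mass g * 𝒯.mass f) = Y * v := by simp only [v]; ring
    rw [this, ← hv, mul_zero]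
  · rw [abs_of_pos hv] at hY'
    have : v * |𝒪.e t G₀ - 𝒪.e t G₁| ≤ v * (Y * v) := by linarith
    refine (le_of_mul_le_mul_left this hv).trans_eq ?_
    simp only [v]; ring

namespace TailBounds
variable (h : 𝒯.TailBounds S α b Ct)
include h

lemma b_nonneg (k : ℕ) : 0 ≤ b k := (𝒯.β_nonneg 0 k).trans (h.le_b 0 k)

lemma β_le {t k : ℕ} {z : ℝ} (hz : 0 < z) (hle : z ≤ 1 + (S (t + k) - S t)) :
    𝒯.β t k ≤ Ct * z ^ (-α) :=
  (h.le_rpow t k).trans (mul_le_mul_of_nonneg_left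
    (Real.rpow_le_rpow_of_nonpos hz hle (neg_nonpos.2 h.α_pos.le)) h.Ct_nonneg)

/-- The last index before the internal time has increased by `z`. -/
lemma exists_first {N t : ℕ} {z : ℝ} (htN : t ≤ N) (hz : 0 < z) (hzN : z ≤ S N - S t) :
    ∃ J, t + J + 1 ≤ N ∧ z ≤ 1 + (S (t + J) - S t) ∧
      ∀ m ≤ J, S (t + m) - S t < z := by
  classical
  have hex : ∃ j, z ≤ S (t + j) - S t := ⟨N - t, by rwa [Nat.add_sub_cancel' htN]⟩
  have hJ := Nat.find_spec hex
  have hmin : ∀ m < Nat.find hex, S (t + m) - S t < z := fun m hm =>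
    not_le.1 (Nat.find_min hex hm)
  have hle : Nat.find hex ≤ N - t := Nat.find_min' hex (by rwa [Nat.add_sub_cancel' htN])
  obtain ⟨J, hJ'⟩ : ∃ J, Nat.find hex = J + 1 := by
    refine Nat.exists_eq_succ_of_ne_zero fun h0 => ?_
    rw [h0] at hJ; simp at hJ; linarith
  rw [hJ'] at hJ hmin hle
  refine ⟨J, by omega, ?_, fun m hm => hmin m (by omega)⟩
  have := h.step (t + J)
  rw [add_assoc] at this
  linarith

/-- Memory loss for two densities at the same time, deduced from that for positive gaps. -/
lemma abs_sub_le_of_gapBound {K A η : ℝ} {N t : ℕ} (𝒪 : 𝒯.Observable N) (hK : 0 ≤ K) (hA : 0 ≤ A)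
    (hη : 0 < η) (hη1 : η < 1) (hM : 0 < S N - S t) (htN : t ≤ N)
    (hgap : ∀ t', t < t' → t' ≤ N → GapBound 𝒯 S α K A η N t' 𝒪)
    {G₀ G₁ : V} (h₀ : G₀ ∈ 𝒯.D) (h₁ : G₁ ∈ 𝒯.D) :
    |𝒯.mass G₀ * 𝒪.e t G₁ - 𝒯.mass G₁ * 𝒪.e t G₀| ≤
      (K * (∑' k, b k + A) + Ct * η ^ (-α)) * (S N - S t) ^ (-α) *
        (𝒯.mass G₀ * 𝒯.mass G₁) := by
  set M := S N - S t with hMdef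
  obtain ⟨J, hJN, hJ1, hJm⟩ := h.exists_first htN (mul_pos hη hM) (by nlinarith)
  have h₁W := 𝒯.D_subset h₁
  have hm₀ := 𝒯.mass_nonneg _ (𝒯.D_subset h₀)
  have hm₁ := 𝒯.mass_nonneg _ h₁W
  have hMα : 0 ≤ M ^ (-α) := Real.rpow_nonneg hM.le _
  have key := 𝒪.abs_sub_le_of_piece t t J h₁W (𝒯.D_subset h₀) (by omega)
    (fun m => K * ((m + 1 : ℕ) + A) * M ^ (-α)) (fun m hm => by
      have h1 : t + (m + 1) = t + 1 + m := by ring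
      have := hgap (t + 1 + m) (by omega) (by omega) t (by omega) G₀ h₀ _
        (piece_mem t m h₁W) hM (by rw [← h1]; exact hJm _ hm)
      rwa [show t + 1 + m - t = m + 1 by omega] at this)
  refine key.trans ?_
  have hmean : ∑ m ∈ Finset.range J, (m : ℝ) * 𝒯.mass (𝒯.piece t m G₁) +
      ∑ m ∈ Finset.range J, 𝒯.mass (𝒯.piece t m G₁) ≤ (∑' k, b k) * 𝒯.mass G₁ := by
    have h1 := sum_mul_mass_piece_le t J h₁W
    have h2 : ∑ m ∈ Finset.range J, 𝒯.mass (𝒯.piece t m G₁) ≤ 𝒯.mass (iterStep 𝒯.A t 0 G₁) := by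
      have := mass_eq_sum_piece t J h₁W
      have := 𝒯.mass_nonneg _ (iterStep_mem t J h₁W)
      simp only [iterStep, id]; linarith
    have h3 := Finset.sum_range_succ' (fun k => 𝒯.mass (iterStep 𝒯.A t k G₁)) J
    have h4 : ∑ k ∈ Finset.range (J + 1), 𝒯.mass (iterStep 𝒯.A t k G₁) ≤
        ∑ k ∈ Finset.range (J + 1), b k * 𝒯.mass G₁ := Finset.sum_le_sum fun k _ =>
      (𝒯.tail t k _ h₁).trans (mul_le_mul_of_nonneg_right (h.le_b t k) hm₁)
    rw [← Finset.sum_mul] at h4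
    have h5 := mul_le_mul_of_nonneg_right
      (h.summable.sum_le_tsum (Finset.range (J + 1)) (fun i _ => h.b_nonneg i)) hm₁
    linarith
  have hone : ∑ m ∈ Finset.range J, 𝒯.mass (𝒯.piece t m G₁) ≤ 𝒯.mass G₁ := by
    have := mass_eq_sum_piece t J h₁W
    have := 𝒯.mass_nonneg _ (iterStep_mem t J h₁W)
    linarith
  have htail : 𝒯.mass (iterStep 𝒯.A t J G₁) ≤ Ct * (η ^ (-α) * M ^ (-α)) * 𝒯.mass G₁ := by
    refine (𝒯.tail t J _ h₁).trans (mul_le_mul_of_nonneg_right ?_ hm₁)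
    rw [← Real.mul_rpow hη.le hM.le]
    exact h.β_le (mul_pos hη hM) hJ1
  have hsum : ∑ m ∈ Finset.range J, K * ((m + 1 : ℕ) + A) * M ^ (-α) * 𝒯.mass (𝒯.piece t m G₁) ≤
      K * M ^ (-α) * ((∑' k, b k + A) * 𝒯.mass G₁) := by
    have : ∑ m ∈ Finset.range J, K * ((m + 1 : ℕ) + A) * M ^ (-α) * 𝒯.mass (𝒯.piece t m G₁) =
        K * M ^ (-α) * ((∑ m ∈ Finset.range J, (m : ℝ) * 𝒯.mass (𝒯.piece t m G₁) +
          ∑ m ∈ Finset.range J, 𝒯.mass (𝒯.piece t m G₁)) +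
          A * ∑ m ∈ Finset.range J, 𝒯.mass (𝒯.piece t m G₁)) := by
      rw [Finset.mul_sum, ← Finset.sum_add_distrib, ← Finset.sum_add_distrib, Finset.mul_sum]
      refine Finset.sum_congr rfl fun m _ => ?_
      push_cast; ring
    rw [this]
    refine mul_le_mul_of_nonneg_left ?_ (mul_nonneg hK hMα)
    linarith [mul_le_mul_of_nonneg_left hone hA]
  calc _ ≤ 𝒯.mass G₀ * (K * M ^ (-α) * ((∑' k, b k + A) * 𝒯.mass G₁) +
        Ct * (η ^ (-α) * M ^ (-α)) * 𝒯.mass G₁) :=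
        mul_le_mul_of_nonneg_left (add_le_add hsum htail) hm₀
    _ = _ := by ring

/-- The inductive step for `GapBound`, before tuning the constants. -/
lemma gapBound_step {c₀ C₁ K A η : ℝ} (hc : ∀ t n, ∀ f ∈ 𝒯.D,
      c₀ * 𝒯.mass f ≤ 𝒯.mass (𝒯.B (𝒯.evol t n f)))
    (hC₁ : ∀ n J : ℕ, ∑ k ∈ Finset.range J, ∑ i ∈ Finset.range (n + 1),
      b (k + 1 + (n - i)) ≤ C₁ + (n + 1) / 4)
    (hK : 0 ≤ K) (hA : 0 ≤ A) (hη : 0 < η) (hη1 : η < 1) {N s n : ℕ} (𝒪 : 𝒯.Observable N)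
    (htN : s + n + 1 ≤ N) (hM : 0 < S N - S (s + n + 1))
    (hgap : ∀ t', s + n + 1 < t' → t' ≤ N → GapBound 𝒯 S α K A η N t' 𝒪)
    {G F : V} (hG : G ∈ 𝒯.D) (hF : F ∈ 𝒯.D') :
    |𝒯.mass G * 𝒪.e (s + n + 1) F - 𝒯.mass F * 𝒪.e s G| ≤
      (K * (∑' k, b k + C₁ + (n + 1) / 4 + A * (1 - 𝒯.ε * c₀)) + Ct * η ^ (-α) * (n + 2)) *
        (S N - S (s + n + 1)) ^ (-α) * (𝒯.mass G * 𝒯.mass F) := by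
  set t' := s + n + 1 with ht'
  set M := S N - S t' with hMdef
  set z := M ^ (-α) with hz
  have hz0 : 0 ≤ z := Real.rpow_nonneg hM.le _
  obtain ⟨J, hJN, hJ1, hJm⟩ := h.exists_first htN (mul_pos hη hM) (by nlinarith)
  set f := 𝒯.evol s n G with hf
  have hfW : f ∈ 𝒯.W := evol_mem s n (𝒯.D_subset hG)
  have hFW := D'_subset_W hF
  have hmf : 𝒯.mass f = 𝒯.mass G := mass_evol s n (𝒯.D_subset hG)
  have hmG := 𝒯.mass_nonneg _ (𝒯.D_subset hG)
  have hmF := 𝒯.mass_nonneg _ hFW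
  have hε := 𝒯.ε_pos
  have hε1 := 𝒯.ε_lt_one
  set Y := (K * (∑' k, b k + A) + Ct * η ^ (-α)) * z with hY
  have hYbound : ∀ G₀ ∈ 𝒯.D, ∀ G₁ ∈ 𝒯.D, |𝒯.mass G₀ * 𝒪.e t' G₁ - 𝒯.mass G₁ * 𝒪.e t' G₀| ≤
      Y * (𝒯.mass G₀ * 𝒯.mass G₁) := fun G₀ h₀ G₁ h₁ =>
    h.abs_sub_le_of_gapBound 𝒪 hK hA hη hη1 hM htN hgap h₀ h₁
  set q : ℕ → ℝ := fun m => 𝒯.mass (𝒯.piece (s + n) m f) with hq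
  have hq0 : ∀ m, 0 ≤ q m := fun m => mass_piece_nonneg _ _ hfW
  set X : ℕ → ℝ := fun m => if m = 0 then (1 - 𝒯.ε) * Y else K * (m + A) * z with hX
  have key := 𝒪.abs_sub_le_of_piece (s + n) t' (J + 1) hfW hFW (by omega) X (fun m hm => by
    rcases Nat.eq_zero_or_pos m with rfl | hm0
    · exact abs_sub_le_of_doeblin 𝒪 hYbound (piece_mem _ 0 hfW) hF
    · have := hgap (t' + m) (by omega) (by omega) t' (by omega) F (𝒯.D'_subset hF) _
        (piece_mem (s + n) m hfW) hM (hJm m (by omega))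
      rw [show t' + m - t' = m by omega] at this
      simp only [hX, hm0.ne', if_false]
      exact this)
  rw [← 𝒪.eq_evol s n (𝒯.D_subset hG) (by omega), hmf, abs_sub_comm] at key
  refine key.trans ?_
  have hmain : ∀ m, X m * q m ≤ K * z * (m * q m) + K * z * A * q m + 
      (if m = 0 then ((1 - 𝒯.ε) * Y - K * z * A) * q 0 else 0) := fun m => by
    by_cases hm : m = 0
    · subst hm; simp [hX]; linarith
    · simp [hX, hm]; linarith
  have hsum : ∑ m ∈ Finset.range (J + 1), X m * q m ≤
      K * z * ∑ m ∈ Finset.range (J + 1), m * q m + K * z * A * ∑ m ∈ Finset.range (J + 1), q m +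
        ((1 - 𝒯.ε) * Y - K * z * A) * q 0 := by
    refine (Finset.sum_le_sum fun m _ => hmain m).trans_eq ?_
    rw [Finset.sum_add_distrib, Finset.sum_add_distrib, Finset.mul_sum, Finset.mul_sum]
    simp
  have hq1 : ∑ m ∈ Finset.range (J + 1), q m ≤ 𝒯.mass G := by
    have := mass_eq_sum_piece (s + n) (J + 1) hfW
    have := 𝒯.mass_nonneg _ (iterStep_mem (s + n) (J + 1) hfW)
    linarith
  have hq00 : q 0 ≤ 𝒯.mass G :=
    (Finset.single_le_sum (fun m _ => hq0 m) (Finset.mem_range.2 J.succ_pos)).trans hq1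
  have hqc : c₀ * 𝒯.mass G ≤ q 0 := hc s n G hG
  have hmean : ∑ m ∈ Finset.range (J + 1), m * q m ≤ (C₁ + (n + 1) / 4) * 𝒯.mass G := by
    refine (sum_mul_mass_piece_le (s + n) (J + 1) hfW).trans ?_
    have h3 := mul_le_mul_of_nonneg_right (hC₁ n (J + 1)) hmG
    rw [Finset.sum_mul] at h3
    exact (Finset.sum_le_sum fun k _ => (mass_iterStep_evol_le s n (k + 1) hG).trans
      (mul_le_mul_of_nonneg_right (Finset.sum_le_sum fun i _ => h.le_b _ _) hmG)).trans h3
  have htail : 𝒯.mass (iterStep 𝒯.A (s + n) (J + 1) f) ≤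
      (n + 1) * (Ct * η ^ (-α) * z) * 𝒯.mass G := by
    refine (mass_iterStep_evol_le s n (J + 1) hG).trans (mul_le_mul_of_nonneg_right ?_ hmG)
    refine (Finset.sum_le_sum (g := fun _ => Ct * η ^ (-α) * z) fun i hi => ?_).trans_eq ?_
    · have hi' := Finset.mem_range.1 hi
      rw [mul_assoc, hz, ← Real.mul_rpow hη.le hM.le]
      refine h.β_le (mul_pos hη hM) ?_
      rw [show s + i + (J + 1 + (n - i)) = t' + J by omega]
      have := h.mono (show s + i ≤ t' by omega)
      linarith
    · simp
  have hηα : 0 ≤ η ^ (-α) := Real.rpow_nonneg hη.le _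
  have hb0 : 0 ≤ ∑' k, b k := tsum_nonneg h.b_nonneg
  have hCz : 0 ≤ Ct * η ^ (-α) * z := mul_nonneg (mul_nonneg h.Ct_nonneg hηα) hz0
  have hKz : 0 ≤ K * z := mul_nonneg hK hz0
  have hlast : ((1 - 𝒯.ε) * Y - K * z * A) * q 0 ≤
      (K * z * ∑' k, b k + Ct * η ^ (-α) * z) * 𝒯.mass G -
        𝒯.ε * (K * z * A) * (c₀ * 𝒯.mass G) := by
    have e1 : ((1 - 𝒯.ε) * Y - K * z * A) * q 0 =
        (1 - 𝒯.ε) * (K * z * ∑' k, b k + Ct * η ^ (-α) * z) * q 0 -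
        𝒯.ε * (K * z * A) * q 0 := by rw [hY]; ring
    rw [e1]
    have p0 : 0 ≤ K * z * ∑' k, b k + Ct * η ^ (-α) * z := add_nonneg (mul_nonneg hKz hb0) hCz
    refine sub_le_sub ?_ (mul_le_mul_of_nonneg_left hqc
      (mul_nonneg hε.le (mul_nonneg hKz hA)))
    refine mul_le_mul ?_ hq00 (hq0 0) p0
    nlinarith
  calc _ ≤ 𝒯.mass F * (K * z * ((C₁ + (n + 1) / 4) * 𝒯.mass G) + K * z * A * 𝒯.mass G +
        ((K * z * ∑' k, b k + Ct * η ^ (-α) * z) * 𝒯.mass G -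
          𝒯.ε * (K * z * A) * (c₀ * 𝒯.mass G)) +
        (n + 1) * (Ct * η ^ (-α) * z) * 𝒯.mass G) := by
        refine mul_le_mul_of_nonneg_left (add_le_add (hsum.trans (add_le_add (add_le_add ?_ ?_)
          hlast)) htail) hmF
        · exact mul_le_mul_of_nonneg_left hmean hKz
        · exact mul_le_mul_of_nonneg_left hq1 (mul_nonneg hKz hA)
    _ = _ := by ring

/-- Memory loss across gaps, with constants independent of the observable and its time. -/
theorem exists_gapBound : ∃ K A η : ℝ, 0 < K ∧ 0 < A ∧ 0 < η ∧ η < 1 ∧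
    ∀ N (𝒪 : 𝒯.Observable N) (t' : ℕ), t' ≤ N → GapBound 𝒯 S α K A η N t' 𝒪 := by
  obtain ⟨c₀, hc0, hc⟩ := exists_le_mass_B_evol h.summable h.le_b
  obtain ⟨C₁, hC10, hC₁⟩ := exists_sum_sum_le h.summable h.b_nonneg
  have hε := 𝒯.ε_pos
  have hεc : 0 < 𝒯.ε * c₀ := mul_pos hε hc0
  obtain ⟨η, hη, hη1, hΛ2, hΛ⟩ : ∃ η : ℝ, 0 < η ∧ η < 1 ∧ (1 - η) ^ (-α) ≤ 2 ∧
      (1 - 𝒯.ε * c₀) * (1 - η) ^ (-α) ≤ 1 - 𝒯.ε * c₀ / 2 := by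
    have hcont : Tendsto (fun η : ℝ => (1 - η) ^ (-α)) (nhdsWithin 0 (Ioi 0)) (nhds 1) := by
      have : ContinuousAt (fun η : ℝ => (1 - η) ^ (-α)) 0 :=
        ContinuousAt.rpow_const (by fun_prop) (Or.inl (by norm_num))
      have h2 := this.tendsto
      simp only [sub_zero, Real.one_rpow] at h2
      exact h2.mono_left nhdsWithin_le_nhds
    have hev1 := (tendsto_order.1 hcont).2 2 (by norm_num)
    have hev2 := (tendsto_order.1 (hcont.const_mul (1 - 𝒯.ε * c₀))).2 (1 - 𝒯.ε * c₀ / 2)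
      (by linarith)
    have hev3 : ∀ᶠ η : ℝ in nhdsWithin 0 (Ioi 0), η ∈ Ioo (0 : ℝ) 1 :=
      Ioo_mem_nhdsGT one_pos
    obtain ⟨η, h1, h2, h3⟩ := (hev1.and (hev2.and hev3)).exists
    exact ⟨η, h3.1, h3.2, h1.le, h2.le⟩
  have hηα : 0 ≤ η ^ (-α) := Real.rpow_nonneg hη.le _
  have hb0 : 0 ≤ ∑' k, b k := tsum_nonneg h.b_nonneg
  set C₃ := Ct * η ^ (-α) with hC₃
  have hC₃0 : 0 ≤ C₃ := mul_nonneg h.Ct_nonneg hηα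
  set A := (2 * (∑' k, b k + C₁) + 1 / 2) / (𝒯.ε * c₀ / 2) with hAdef
  have hA : 0 < A := by positivity
  have hAeq : A * (𝒯.ε * c₀ / 2) = 2 * (∑' k, b k + C₁) + 1 / 2 :=
    div_mul_cancel₀ _ (by positivity)
  set K := 4 * C₃ + 1 with hKdef
  have hK : 0 < K := by positivity
  refine ⟨K, A, η, hK, hA, hη, hη1, fun N 𝒪 => ?_⟩
  suffices H : ∀ d t', t' ≤ N → N ≤ t' + d → GapBound 𝒯 S α K A η N t' 𝒪 from
    fun t' ht' => H N t' ht' (by omega)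
  intro d
  induction d with
  | zero =>
    intro t' h1 h2 t ht G hG F hF hM hlt
    obtain rfl : t' = N := by omega
    nlinarith
  | succ d ih =>
    intro t' h1 h2 t ht G hG F hF hM hlt
    obtain ⟨n, rfl⟩ : ∃ n, t' = t + n + 1 := ⟨t' - t - 1, by omega⟩
    have hM' : (1 - η) * (S N - S t) ≤ S N - S (t + n + 1) := by linarith
    have hM'0 : 0 < (1 - η) * (S N - S t) := mul_pos (by linarith) hM
    have step := h.gapBound_step hc hC₁ hK.le hA.le hη hη1 𝒪 h1 (hM'0.trans_le hM')
      (fun t'' h3 h4 => ih t'' h4 (by omega)) hG hF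
    refine step.trans ?_
    have hmm : 0 ≤ 𝒯.mass G * 𝒯.mass F := mul_nonneg (𝒯.mass_nonneg _ (𝒯.D_subset hG))
      (𝒯.mass_nonneg _ (D'_subset_W hF))
    refine mul_le_mul_of_nonneg_right ?_ hmm
    have hMα : 0 ≤ (S N - S t) ^ (-α) := Real.rpow_nonneg hM.le _
    have hz : (S N - S (t + n + 1)) ^ (-α) ≤ (1 - η) ^ (-α) * (S N - S t) ^ (-α) := by
      rw [← Real.mul_rpow (by linarith) hM.le]
      exact Real.rpow_le_rpow_of_nonpos hM'0 hM' (neg_nonpos.2 h.α_pos.le)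
    set Λ := (1 - η) ^ (-α) with hΛdef
    have hcoef : 0 ≤ K * (∑' k, b k + C₁ + (n + 1) / 4 + A * (1 - 𝒯.ε * c₀)) + C₃ * (n + 2) ∨
        K * (∑' k, b k + C₁ + (n + 1) / 4 + A * (1 - 𝒯.ε * c₀)) + C₃ * (n + 2) < 0 :=
      le_or_gt 0 _
    have hn : (0 : ℝ) ≤ n := n.cast_nonneg
    rw [show t + n + 1 - t = n + 1 by omega]
    rcases hcoef with hp | hp
    · refine (mul_le_mul_of_nonneg_left hz hp).trans ?_
      rw [← mul_assoc]
      refine mul_le_mul_of_nonneg_right ?_ hMα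
      have a1 : (∑' k, b k + C₁ + (n + 1) / 4) * Λ ≤ (∑' k, b k + C₁ + (n + 1) / 4) * 2 :=
        mul_le_mul_of_nonneg_left hΛ2 (by positivity)
      have a2 := mul_le_mul_of_nonneg_left hΛ hA.le
      have a3 : C₃ * (n + 2) * Λ ≤ C₃ * (n + 2) * 2 :=
        mul_le_mul_of_nonneg_left hΛ2 (by positivity)
      have a4 : C₃ * (n + 2) * 2 ≤ K * ((n + 2) / 2) := by rw [hKdef]; nlinarith
      have a5 := mul_le_mul_of_nonneg_left (add_le_add a1 a2) hK.le
      push_cast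
      have a6 : K * ((∑' k, b k + C₁ + (n + 1) / 4) * 2 + A * (1 - 𝒯.ε * c₀ / 2)) =
          K * ((n + 1) / 2 + A - 1 / 2) := by
        have : A * (1 - 𝒯.ε * c₀ / 2) = A - (2 * (∑' k, b k + C₁) + 1 / 2) := by
          rw [← hAeq]; ring
        rw [this]; ring
      nlinarith
    · have l1 := mul_nonpos_of_nonpos_of_nonneg hp.le
        (Real.rpow_nonneg (hM'0.trans_le hM').le (-α))
      refine l1.trans ?_
      positivity

/-- Memory loss for two regular densities. -/
theorem exists_abs_sub_le_of_mem : ∃ C : ℝ, ∀ N (𝒪 : 𝒯.Observable N), 0 < S N - S 0 →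
    ∀ G₀ ∈ 𝒯.D, ∀ G₁ ∈ 𝒯.D, |𝒯.mass G₀ * 𝒪.e 0 G₁ - 𝒯.mass G₁ * 𝒪.e 0 G₀| ≤
      C * (S N - S 0) ^ (-α) * (𝒯.mass G₀ * 𝒯.mass G₁) := by
  obtain ⟨K, A, η, hK, hA, hη, hη1, H⟩ := h.exists_gapBound
  exact ⟨_, fun N 𝒪 hM G₀ h₀ G₁ h₁ => h.abs_sub_le_of_gapBound 𝒪 hK.le hA.le hη hη1 hM N.zero_le
    (fun t' _ ht' => H N 𝒪 t' ht') h₀ h₁⟩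

/-- Memory loss between an arbitrary admissible density and a regular one: there is an additional
contribution of the mass of the former that waits for a positive proportion of the time. -/
theorem exists_abs_sub_le : ∃ C η : ℝ, 0 ≤ C ∧ 0 < η ∧ ∀ N (𝒪 : 𝒯.Observable N),
    0 < S N - S 0 → ∀ f ∈ 𝒯.W, ∀ H ∈ 𝒯.D, ∃ J, η * (S N - S 0) ≤ 1 + (S J - S 0) ∧
      |𝒯.mass H * 𝒪.e 0 f - 𝒯.mass f * 𝒪.e 0 H| ≤
        𝒯.mass H * (C * N * (S N - S 0) ^ (-α) * 𝒯.mass f + 𝒯.mass (iterStep 𝒯.A 0 J f)) := by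
  obtain ⟨K, A, η, hK, hA, hη, hη1, hgap⟩ := h.exists_gapBound
  refine ⟨K * (1 + A), η, by positivity, hη, fun N 𝒪 hM f hf H hH => ?_⟩
  obtain ⟨J, hJN, hJ1, hJm⟩ := h.exists_first N.zero_le (mul_pos hη hM) (by nlinarith)
  simp only [zero_add] at hJN hJ1 hJm
  have hHW := 𝒯.D_subset hH
  have hMα : 0 ≤ (S N - S 0) ^ (-α) := Real.rpow_nonneg hM.le _
  refine ⟨J, hJ1, ?_⟩
  refine (𝒪.abs_sub_le_of_piece 0 0 J hf hHW (by omega)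
    (fun _ => K * (1 + A) * N * (S N - S 0) ^ (-α)) fun m hm => ?_).trans ?_
  · have := hgap N 𝒪 (0 + 1 + m) (by omega) 0 (by omega) H hH _ (piece_mem 0 m hf) hM
      (by simpa [add_comm] using hJm (m + 1) (by omega))
    refine this.trans (mul_le_mul_of_nonneg_right (mul_le_mul_of_nonneg_right ?_ hMα)
      (mul_nonneg (𝒯.mass_nonneg _ hHW) (mass_piece_nonneg 0 m hf)))
    rw [mul_assoc]
    refine mul_le_mul_of_nonneg_left ?_ hK.le
    have h1 : ((0 + 1 + m - 0 : ℕ) : ℝ) ≤ N := by exact_mod_cast (by omega)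
    have h2 : (1 : ℝ) ≤ N := by exact_mod_cast (by omega)
    nlinarith
  · refine mul_le_mul_of_nonneg_left (add_le_add ?_ le_rfl) (𝒯.mass_nonneg _ hHW)
    rw [← Finset.mul_sum]
    refine mul_le_mul_of_nonneg_left ?_ (by positivity)
    have := mass_eq_sum_piece 0 J hf
    have := 𝒯.mass_nonneg _ (iterStep_mem 0 J hf)
    linarith

end TailBounds
end TransferScheme

/-- The left branch of the map `lsv γ`. -/
def leftBranch (γ x : ℝ) : ℝ := x * (1 + 2 ^ γ * x ^ γ)

/-- The derivative of `leftBranch γ`. -/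
def leftDeriv (γ x : ℝ) : ℝ := 1 + (1 + γ) * (2 * x) ^ γ

/-- The inverse of `leftBranch γ`, from `(0,1]` to `(0,1/2]`. -/
def leftInv (γ : ℝ) : ℝ → ℝ := Function.invFunOn (leftBranch γ) (Ioc 0 (1 / 2))

lemma leftBranch_eq {γ x : ℝ} (hx : 0 ≤ x) : leftBranch γ x = x * (1 + (2 * x) ^ γ) := by
  rw [leftBranch, Real.mul_rpow zero_le_two hx]

lemma leftDeriv_pos {γ x : ℝ} (hγ : 0 < γ) (hx : 0 ≤ x) : 0 < leftDeriv γ x := by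
  unfold leftDeriv; positivity

lemma one_le_leftDeriv {γ x : ℝ} (hγ : 0 < γ) (hx : 0 ≤ x) : 1 ≤ leftDeriv γ x := by
  have : 0 ≤ (1 + γ) * (2 * x) ^ γ := by positivity
  unfold leftDeriv; linarith

lemma leftDeriv_mono {γ x y : ℝ} (hγ : 0 < γ) (hx : 0 ≤ x) (hxy : x ≤ y) :
    leftDeriv γ x ≤ leftDeriv γ y := by
  unfold leftDeriv; gcongr

lemma hasDerivAt_leftBranch {γ x : ℝ} (hx : 0 < x) :
    HasDerivAt (leftBranch γ) (leftDeriv γ x) x := by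
  have h := (hasDerivAt_id x).mul
    (((Real.hasDerivAt_rpow_const (p := γ) (Or.inl hx.ne')).const_mul (2 ^ γ)).const_add 1)
  refine h.congr_deriv ?_
  have : x * x ^ (γ - 1) = x ^ γ := by rw [Real.rpow_sub_one hx.ne']; field_simp
  rw [leftDeriv, Real.mul_rpow zero_le_two hx.le]
  simp only [id]
  linear_combination (2 ^ γ * γ) * this

/-- The left branch is expanding. -/
lemma sub_le_leftBranch_sub {γ x y : ℝ} (hγ : 0 < γ) (hx : 0 ≤ x) (hxy : x ≤ y) :
    y - x ≤ leftBranch γ y - leftBranch γ x := by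
  rw [leftBranch_eq hx, leftBranch_eq (hx.trans hxy)]
  have : x * (2 * x) ^ γ ≤ y * (2 * y) ^ γ := by gcongr; linarith
  linarith

lemma strictMonoOn_leftBranch {γ : ℝ} (hγ : 0 < γ) : StrictMonoOn (leftBranch γ) (Ici 0) :=
  fun x hx y _ hxy => by
    have := sub_le_leftBranch_sub hγ (mem_Ici.1 hx) hxy.le
    linarith

lemma leftBranch_half (γ : ℝ) : leftBranch γ (1 / 2) = 1 := by
  rw [leftBranch_eq (by norm_num)]; norm_num

lemma continuous_leftBranch {γ : ℝ} (hγ : 0 < γ) : Continuous (leftBranch γ) := by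
  unfold leftBranch
  exact continuous_id.mul (continuous_const.add
    (continuous_const.mul (Real.continuous_rpow_const hγ.le)))

lemma image_leftBranch {γ c : ℝ} (hγ : 0 < γ) (hc : 0 ≤ c) :
    leftBranch γ '' Ioc 0 c = Ioc 0 (leftBranch γ c) := by
  have h0 : leftBranch γ 0 = 0 := by simp [leftBranch]
  refine Subset.antisymm ?_ ?_
  · rintro _ ⟨x, hx, rfl⟩
    have hm := strictMonoOn_leftBranch hγ
    refine ⟨h0 ▸ hm (mem_Ici.2 le_rfl) (mem_Ici.2 hx.1.le) hx.1,
      hm.monotoneOn (mem_Ici.2 hx.1.le) (mem_Ici.2 hc) hx.2⟩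
  · have := intermediate_value_Ioc hc (continuous_leftBranch hγ).continuousOn
    rwa [h0] at this

lemma image_leftBranch_half {γ : ℝ} (hγ : 0 < γ) :
    leftBranch γ '' Ioc 0 (1 / 2) = Ioc 0 1 := by
  rw [image_leftBranch hγ (by norm_num), leftBranch_half]

section leftInv
variable {γ : ℝ} (hγ : 0 < γ)
include hγ

lemma leftInv_mem {x : ℝ} (hx : x ∈ Ioc (0 : ℝ) 1) : leftInv γ x ∈ Ioc (0 : ℝ) (1 / 2) :=
  Function.invFunOn_mem (by rw [← image_leftBranch_half hγ] at hx; exact hx)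

lemma leftBranch_leftInv {x : ℝ} (hx : x ∈ Ioc (0 : ℝ) 1) : leftBranch γ (leftInv γ x) = x :=
  Function.invFunOn_eq (by rw [← image_leftBranch_half hγ] at hx; exact hx)

lemma leftInv_leftBranch {x : ℝ} (hx : x ∈ Ioc (0 : ℝ) (1 / 2)) :
    leftInv γ (leftBranch γ x) = x := by
  have hx' : leftBranch γ x ∈ Ioc (0 : ℝ) 1 := image_leftBranch_half hγ ▸ mem_image_of_mem _ hx
  exact (strictMonoOn_leftBranch hγ).injOn (mem_Ici.2 (leftInv_mem hγ hx').1.le)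
    (mem_Ici.2 hx.1.le) (leftBranch_leftInv hγ hx')

lemma leftInv_one : leftInv γ 1 = 1 / 2 := by
  have := leftInv_leftBranch hγ (x := 1 / 2) (by norm_num)
  rwa [leftBranch_half] at this

lemma leftInv_mono {x y : ℝ} (hx : x ∈ Ioc (0 : ℝ) 1) (hy : y ∈ Ioc (0 : ℝ) 1) (hxy : x ≤ y) :
    leftInv γ x ≤ leftInv γ y := by
  rw [← leftBranch_leftInv hγ hx, ← leftBranch_leftInv hγ hy] at hxy
  exact ((strictMonoOn_leftBranch hγ).le_iff_le (mem_Ici.2 (leftInv_mem hγ hx).1.le)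
    (mem_Ici.2 (leftInv_mem hγ hy).1.le)).1 hxy

lemma leftInv_le {x : ℝ} (hx : x ∈ Ioc (0 : ℝ) 1) : leftInv γ x ≤ x := by
  have h := leftInv_mem hγ hx
  have := sub_le_leftBranch_sub hγ le_rfl h.1.le
  rw [leftBranch_leftInv hγ hx, leftBranch_eq le_rfl] at this
  linarith

end leftInv

/-- The contribution to the Perron–Frobenius operator of `lsv γ` of the left branch. -/
def leftTransfer (γ : ℝ) (f : ℝ → ℝ) (x : ℝ) : ℝ := f (leftInv γ x) / leftDeriv γ (leftInv γ x)

/-- The contribution to the Perron–Frobenius operator of `lsv γ` of the right branch. -/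
def rightTransfer (f : ℝ → ℝ) (x : ℝ) : ℝ := f ((x + 1) / 2) / 2

lemma injOn_leftBranch {γ c : ℝ} (hγ : 0 < γ) : InjOn (leftBranch γ) (Ioc 0 c) :=
  (strictMonoOn_leftBranch hγ).injOn.mono fun _ hx => mem_Ici.2 hx.1.le

lemma leftDeriv_mul_leftTransfer {γ c x : ℝ} (hγ : 0 < γ) (hc : c ≤ 1 / 2) (f φ : ℝ → ℝ)
    (hx : x ∈ Ioc 0 c) : |leftDeriv γ x| • (leftTransfer γ f (leftBranch γ x) *
      φ (leftBranch γ x)) = f x * φ (leftBranch γ x) := by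
  have hd := leftDeriv_pos hγ hx.1.le
  rw [leftTransfer, leftInv_leftBranch hγ ⟨hx.1, hx.2.trans hc⟩, abs_of_pos hd, smul_eq_mul]
  field_simp

lemma setIntegral_leftTransfer_mul {γ c : ℝ} (hγ : 0 < γ) (hc0 : 0 ≤ c) (hc : c ≤ 1 / 2)
    (f φ : ℝ → ℝ) : ∫ x in Ioc 0 (leftBranch γ c), leftTransfer γ f x * φ x =
      ∫ x in Ioc 0 c, f x * φ (leftBranch γ x) := by
  rw [← image_leftBranch hγ hc0, integral_image_eq_integral_abs_deriv_smul measurableSet_Ioc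
    (fun x hx => (hasDerivAt_leftBranch hx.1).hasDerivWithinAt) (injOn_leftBranch hγ)]
  exact setIntegral_congr_fun measurableSet_Ioc fun x hx => leftDeriv_mul_leftTransfer hγ hc f φ hx

lemma integrableOn_leftTransfer {γ : ℝ} (hγ : 0 < γ) {f : ℝ → ℝ} (hf : IntegrableOn f (Ioc 0 1)) :
    IntegrableOn (leftTransfer γ f) (Ioc 0 1) := by
  rw [← image_leftBranch_half hγ, integrableOn_image_iff_integrableOn_abs_deriv_smul
    measurableSet_Ioc (fun x hx => (hasDerivAt_leftBranch hx.1).hasDerivWithinAt)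
    (injOn_leftBranch hγ)]
  refine (hf.mono_set (Ioc_subset_Ioc_right (by norm_num))).congr_fun (fun x hx => ?_)
    measurableSet_Ioc
  simpa using (leftDeriv_mul_leftTransfer hγ le_rfl f (fun _ => 1) hx).symm

lemma image_right : (fun u : ℝ => (u + 1) / 2) '' Ioc 0 1 = Ioc (1 / 2) 1 := by
  ext x
  constructor
  · rintro ⟨u, hu, rfl⟩
    constructor <;> linarith [hu.1, hu.2]
  · intro hx
    refine ⟨2 * x - 1, ⟨by linarith [hx.1], by linarith [hx.2]⟩, by ring⟩

lemma hasDerivAt_right (x : ℝ) : HasDerivAt (fun u : ℝ => (u + 1) / 2) (1 / 2) x :=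
  ((hasDerivAt_id x).add_const 1).div_const 2

lemma injOn_right (s : Set ℝ) : InjOn (fun u : ℝ => (u + 1) / 2) s := fun x _ y _ h => by
  simp only at h; linarith

lemma setIntegral_rightTransfer_mul (f φ : ℝ → ℝ) :
    ∫ x in Ioc 0 1, rightTransfer f x * φ x = ∫ x in Ioc (1 / 2) 1, f x * φ (2 * (x - 1 / 2)) := by
  rw [← image_right, integral_image_eq_integral_abs_deriv_smul measurableSet_Ioc
    (fun x _ => (hasDerivAt_right x).hasDerivWithinAt) (injOn_right _)]
  refine setIntegral_congr_fun measurableSet_Ioc fun x _ => ?_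
  have : 2 * ((x + 1) / 2 - 1 / 2) = x := by ring
  simp only [rightTransfer, this, smul_eq_mul, abs_of_pos (one_half_pos (α := ℝ))]
  ring

lemma integrableOn_rightTransfer {f : ℝ → ℝ} (hf : IntegrableOn f (Ioc 0 1)) :
    IntegrableOn (rightTransfer f) (Ioc 0 1) := by
  have h : IntegrableOn f ((fun u : ℝ => (u + 1) / 2) '' Ioc 0 1) := by
    rw [image_right]; exact hf.mono_set (Ioc_subset_Ioc_left (by norm_num))
  rw [integrableOn_image_iff_integrableOn_abs_deriv_smul measurableSet_Ioc
    (fun x _ => (hasDerivAt_right x).hasDerivWithinAt) (injOn_right _)] at h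
  refine h.congr_fun (fun x _ => ?_) measurableSet_Ioc
  simp only [rightTransfer, smul_eq_mul, abs_of_pos (one_half_pos (α := ℝ))]
  ring

/-- Duality between composition with `lsv γ` and the transfer operator. -/
lemma setIntegral_mul_comp_lsv {γ : ℝ} (hγ : 0 < γ) (f φ : ℝ → ℝ)
    (h : IntegrableOn (fun x => f x * φ (lsv γ x)) (Ioc 0 1)) :
    ∫ x in Ioc 0 1, f x * φ (lsv γ x) = (∫ x in Ioc 0 1, leftTransfer γ f x * φ x) +
      ∫ x in Ioc 0 1, rightTransfer f x * φ x := by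
  have hl := setIntegral_leftTransfer_mul hγ (by norm_num) le_rfl f φ
  rw [leftBranch_half] at hl
  rw [hl, setIntegral_rightTransfer_mul, ← Ioc_union_Ioc_eq_Ioc (b := (1 / 2 : ℝ)) (by norm_num)
    (by norm_num), setIntegral_union (Ioc_disjoint_Ioc_of_le le_rfl) measurableSet_Ioc
    (h.mono_set (Ioc_subset_Ioc_right (by norm_num)))
    (h.mono_set (Ioc_subset_Ioc_left (by norm_num)))]
  congr 1
  · rw [integral_Ioc_eq_integral_Ioo, integral_Ioc_eq_integral_Ioo]
    refine setIntegral_congr_fun measurableSet_Ioo fun x hx => ?_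
    simp only [lsv, leftBranch, if_pos hx.2]
  · refine setIntegral_congr_fun measurableSet_Ioc fun x hx => ?_
    simp only [lsv, if_neg hx.1.not_gt]

lemma measurable_lsv (γ : ℝ) : Measurable (lsv γ) := by
  unfold lsv
  exact Measurable.ite measurableSet_Iio (by fun_prop) (by fun_prop)

lemma measurable_seqComp_lsv (ω : ℕ → ℝ) (k n : ℕ) :
    Measurable (seqComp (fun i => lsv (ω i)) k n) := by
  induction n with
  | zero => exact measurable_id
  | succ n ih => exact (measurable_lsv _).comp ih

lemma seqComp_succ' {X : Type*} (T : ℕ → X → X) (k n : ℕ) (x : X) :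
    seqComp T k (n + 1) x = seqComp T (k + 1) n (T k x) := by
  induction n with
  | zero => rfl
  | succ n ih =>
    change T (k + (n + 1)) (seqComp T k (n + 1) x) = T (k + 1 + n) _
    rw [ih]; congr 1; omega

/-- Integrable nonnegative densities on `(0,1]` which are locally log-Hölder, with constant `K` and
exponent `h`, up to a distortion `(y/x)^2`. -/
def admissible (K h : ℝ) : Set (ℝ → ℝ) :=
  {f | IntegrableOn f (Ioc 0 1) ∧ (∀ x ∈ Ioc (0 : ℝ) 1, 0 ≤ f x) ∧
    ∀ x y, 0 < x → x ≤ y → y ≤ 1 → f x ≤ Real.exp (K * (y - x) ^ h) * (y / x) ^ 2 * f y ∧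
      f y ≤ Real.exp (K * (y - x) ^ h) * (y / x) ^ 2 * f x}

/-- Integrable nonnegative densities on `(0,1]` which are log-Hölder with constant `K` and
exponent `h`. -/
def logHolder (K h : ℝ) : Set (ℝ → ℝ) :=
  {f | IntegrableOn f (Ioc 0 1) ∧ (∀ x ∈ Ioc (0 : ℝ) 1, 0 ≤ f x) ∧
    ∀ x ∈ Ioc (0 : ℝ) 1, ∀ y ∈ Ioc (0 : ℝ) 1, f x ≤ Real.exp (K * |x - y| ^ h) * f y}

lemma logHolder_mono {K K' h : ℝ} (hK : K ≤ K') : logHolder K h ⊆ logHolder K' h := by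
  rintro f ⟨h1, h2, h3⟩
  refine ⟨h1, h2, fun x hx y hy => (h3 x hx y hy).trans ?_⟩
  have := h2 y hy
  gcongr

lemma logHolder_subset_admissible {K h : ℝ} : logHolder K h ⊆ admissible K h := by
  rintro f ⟨h1, h2, h3⟩
  refine ⟨h1, h2, fun x y hx hxy hy => ?_⟩
  have hy' : y ∈ Ioc (0 : ℝ) 1 := ⟨hx.trans_le hxy, hy⟩
  have hx' : x ∈ Ioc (0 : ℝ) 1 := ⟨hx, hxy.trans hy⟩
  have a := h3 x hx' y hy'
  have b := h3 y hy' x hx'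
  rw [abs_sub_comm, abs_of_nonneg (sub_nonneg.2 hxy)] at a
  rw [abs_of_nonneg (sub_nonneg.2 hxy)] at b
  have hr : 1 ≤ (y / x) ^ 2 := one_le_pow₀ ((one_le_div hx).2 hxy)
  refine ⟨a.trans ?_, b.trans ?_⟩ <;>
  · refine mul_le_mul_of_nonneg_right ?_ (by first | exact h2 _ hx' | exact h2 _ hy')
    exact le_mul_of_one_le_right (Real.exp_pos _).le hr

lemma admissible_add {K h : ℝ} {f g : ℝ → ℝ} (hf : f ∈ admissible K h) (hg : g ∈ admissible K h) :
    f + g ∈ admissible K h := by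
  refine ⟨hf.1.add hg.1, fun x hx => add_nonneg (hf.2.1 x hx) (hg.2.1 x hx),
    fun x y hx hxy hy => ?_⟩
  have a := hf.2.2 x y hx hxy hy
  have b := hg.2.2 x y hx hxy hy
  simp only [Pi.add_apply, mul_add]
  exact ⟨add_le_add a.1 b.1, add_le_add a.2 b.2⟩

/-- Distortion of the left branch. -/
lemma leftDeriv_le_mul_sq {γ x y : ℝ} (hγ : 0 < γ) (hγ1 : γ ≤ 1) (hx : 0 < x) (hxy : x ≤ y) :
    leftDeriv γ y * (y / x) ^ 2 ≤ (leftBranch γ y / leftBranch γ x) ^ 2 * leftDeriv γ x := by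
  have hy := hx.trans_le hxy
  have h1 : (2 * x) ^ γ ≤ (2 * y) ^ γ := by gcongr
  rw [leftBranch_eq hx.le, leftBranch_eq hy.le, leftDeriv, leftDeriv]
  have h0 : 0 ≤ (2 * x) ^ γ := by positivity
  set w := (2 * x) ^ γ
  set v := (2 * y) ^ γ
  have key : (1 + (1 + γ) * v) * (1 + w) ^ 2 ≤ (1 + v) ^ 2 * (1 + (1 + γ) * w) := by
    have : (1 + v) ^ 2 * (1 + (1 + γ) * w) - (1 + (1 + γ) * v) * (1 + w) ^ 2 =
      (v - w) * (1 - γ + v + w + (1 + γ) * w * v) := by ring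
    have h2 : 0 ≤ (v - w) * (1 - γ + v + w + (1 + γ) * w * v) :=
      mul_nonneg (by linarith) (by
        have := mul_nonneg (mul_nonneg (by linarith : 0 ≤ 1 + γ) h0) (h0.trans h1)
        linarith)
    linarith
  rw [mul_div_mul_comm, mul_pow, mul_comm, mul_assoc]
  refine mul_le_mul_of_nonneg_left ?_ (by positivity)
  rw [div_pow, div_mul_eq_mul_div, le_div_iff₀ (by positivity)]
  exact key

lemma div_le_leftBranch_div {γ x y : ℝ} (hγ : 0 < γ) (hx : 0 < x) (hxy : x ≤ y) :
    y / x ≤ leftBranch γ y / leftBranch γ x := by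
  have hy := hx.trans_le hxy
  have h1 : (2 * x) ^ γ ≤ (2 * y) ^ γ := by gcongr
  rw [leftBranch_eq hx.le, leftBranch_eq hy.le, mul_div_mul_comm]
  exact le_mul_of_one_le_right (by positivity) ((one_le_div (by positivity)).2 (by linarith))

lemma leftTransfer_mem_admissible {γ K h : ℝ} (hγ : 0 < γ) (hγ1 : γ ≤ 1) (hK : 0 ≤ K) (hh : 0 ≤ h)
    {f : ℝ → ℝ} (hf : f ∈ admissible K h) : leftTransfer γ f ∈ admissible K h := by
  refine ⟨integrableOn_leftTransfer hγ hf.1, fun x hx => ?_, fun x y hx hxy hy => ?_⟩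
  · have hz := leftInv_mem hγ hx
    exact div_nonneg (hf.2.1 _ ⟨hz.1, hz.2.trans (by norm_num)⟩) (leftDeriv_pos hγ hz.1.le).le
  have hx' : x ∈ Ioc (0 : ℝ) 1 := ⟨hx, hxy.trans hy⟩
  have hy' : y ∈ Ioc (0 : ℝ) 1 := ⟨hx.trans_le hxy, hy⟩
  have hzw := leftInv_mono hγ hx' hy' hxy
  have hz := leftInv_mem hγ hx'
  have hw := leftInv_mem hγ hy'
  have ex := leftBranch_leftInv hγ hx'
  have ey := leftBranch_leftInv hγ hy'
  unfold leftTransfer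
  set z := leftInv γ x
  set w := leftInv γ y
  have hd := sub_le_leftBranch_sub hγ hz.1.le hzw
  have hR := div_le_leftBranch_div hγ hz.1 hzw
  have hD := leftDeriv_le_mul_sq hγ hγ1 hz.1 hzw
  have hDm := leftDeriv_mono hγ hz.1.le hzw
  rw [ex, ey] at hd hR hD
  have hz1 : z ∈ Ioc (0 : ℝ) 1 := ⟨hz.1, hz.2.trans (by norm_num)⟩
  have hw1 : w ∈ Ioc (0 : ℝ) 1 := ⟨hw.1, hw.2.trans (by norm_num)⟩
  have fz := hf.2.1 z hz1
  have fw := hf.2.1 w hw1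
  obtain ⟨h1, h2⟩ := hf.2.2 z w hz.1 hzw hw1.2
  have hDz := leftDeriv_pos hγ hz.1.le
  have hDw := leftDeriv_pos hγ hw.1.le
  have hE : Real.exp (K * (w - z) ^ h) ≤ Real.exp (K * (y - x) ^ h) := by gcongr
  have hwz : 0 ≤ w / z := (div_pos hw.1 hz.1).le
  set E := Real.exp (K * (w - z) ^ h)
  set E' := Real.exp (K * (y - x) ^ h)
  have hE0 : 0 ≤ E := (Real.exp_pos _).le
  have hE0' : 0 ≤ E' := (Real.exp_pos _).le
  constructor
  · rw [← mul_div_assoc, div_le_div_iff₀ hDz hDw]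
    calc f z * leftDeriv γ w ≤ E * (w / z) ^ 2 * f w * leftDeriv γ w := by gcongr
      _ = E * f w * (leftDeriv γ w * (w / z) ^ 2) := by ring
      _ ≤ E' * f w * ((y / x) ^ 2 * leftDeriv γ z) := by gcongr
      _ = _ := by ring
  · rw [← mul_div_assoc, div_le_div_iff₀ hDw hDz]
    calc f w * leftDeriv γ z ≤ E * (w / z) ^ 2 * f z * leftDeriv γ z := by gcongr
      _ ≤ E' * (y / x) ^ 2 * f z * leftDeriv γ w := by gcongr

lemma rightTransfer_mem_logHolder {K h : ℝ} (hh1 : h ≤ 1)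
    {f : ℝ → ℝ} (hf : f ∈ admissible K h) :
    rightTransfer f ∈ logHolder (K * (1 / 2) ^ h + 2) h := by
  have hmem : ∀ x ∈ Ioc (0 : ℝ) 1, (x + 1) / 2 ∈ Ioc (0 : ℝ) 1 := fun x hx =>
    ⟨by linarith [hx.1], by linarith [hx.2]⟩
  refine ⟨integrableOn_rightTransfer hf.1, fun x hx => ?_, ?_⟩
  · exact div_nonneg (hf.2.1 _ (hmem x hx)) zero_le_two
  have key : ∀ x ∈ Ioc (0 : ℝ) 1, ∀ y ∈ Ioc (0 : ℝ) 1, x ≤ y →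
      rightTransfer f x ≤ Real.exp ((K * (1 / 2) ^ h + 2) * |x - y| ^ h) * rightTransfer f y ∧
      rightTransfer f y ≤ Real.exp ((K * (1 / 2) ^ h + 2) * |x - y| ^ h) * rightTransfer f x := by
    intro x hx y hy hxy
    have hd : 0 ≤ y - x := sub_nonneg.2 hxy
    obtain ⟨h1, h2⟩ := hf.2.2 ((x + 1) / 2) ((y + 1) / 2) (hmem x hx).1 (by linarith) (hmem y hy).2
    have hle : Real.exp (K * ((y + 1) / 2 - (x + 1) / 2) ^ h) * ((y + 1) / 2 / ((x + 1) / 2)) ^ 2 ≤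
        Real.exp ((K * (1 / 2) ^ h + 2) * |x - y| ^ h) := by
      rw [abs_sub_comm, abs_of_nonneg hd, add_mul, Real.exp_add,
        show (y + 1) / 2 - (x + 1) / 2 = 1 / 2 * (y - x) by ring,
        Real.mul_rpow (by norm_num) hd, ← mul_assoc]
      refine mul_le_mul_of_nonneg_left ?_ (Real.exp_pos _).le
      have e1 : y - x ≤ (y - x) ^ h :=
        Real.self_le_rpow_of_le_one hd (by linarith [hx.1, hy.2]) hh1
      have e2 : (y + 1) / 2 / ((x + 1) / 2) ≤ Real.exp ((y - x) ^ h) := by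
        have hx1 : 0 < x + 1 := by linarith [hx.1]
        have e3 := Real.add_one_le_exp ((y - x) ^ h)
        rw [div_div_div_cancel_right₀ two_ne_zero, div_le_iff₀ hx1]
        nlinarith [hx.1]
      have e4 : 0 ≤ (y + 1) / 2 / ((x + 1) / 2) :=
        div_nonneg (hmem y hy).1.le (hmem x hx).1.le
      calc _ ≤ Real.exp ((y - x) ^ h) ^ 2 := by gcongr
        _ = _ := by rw [← Real.exp_nat_mul]; norm_num
    have p := hf.2.1 _ (hmem x hx)
    have q := hf.2.1 _ (hmem y hy)
    have h1' := h1.trans (mul_le_mul_of_nonneg_right hle q)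
    have h2' := h2.trans (mul_le_mul_of_nonneg_right hle p)
    unfold rightTransfer
    constructor <;> linarith
  intro x hx y hy
  rcases le_total x y with hxy | hxy
  · exact (key x hx y hy hxy).1
  · rw [abs_sub_comm]; exact (key y hy x hx hxy).2

/-- The total mass of a density. -/
def unitMass (f : ℝ → ℝ) : ℝ := ∫ x in Ioc 0 1, f x

lemma unitMass_const (c : ℝ) : unitMass (fun _ => c) = c := by simp [unitMass]

lemma unitMass_nonneg {f : ℝ → ℝ} (hf : ∀ x ∈ Ioc (0 : ℝ) 1, 0 ≤ f x) : 0 ≤ unitMass f :=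
  setIntegral_nonneg measurableSet_Ioc hf

section logHolder
variable {K h : ℝ} (hK : 0 ≤ K) (hh : 0 < h) {f : ℝ → ℝ} (hf : f ∈ logHolder K h)
include hK hh hf

lemma le_exp_mul_of_mem_logHolder {x y : ℝ} (hx : x ∈ Ioc (0 : ℝ) 1) (hy : y ∈ Ioc (0 : ℝ) 1) :
    f x ≤ Real.exp K * f y := by
  refine (hf.2.2 x hx y hy).trans (mul_le_mul_of_nonneg_right (Real.exp_le_exp.2 ?_)
    (hf.2.1 y hy))
  refine mul_le_of_le_one_right hK (Real.rpow_le_one (abs_nonneg _) ?_ hh.le)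
  rw [abs_le]; constructor <;> linarith [hx.1, hx.2, hy.1, hy.2]

lemma le_exp_mul_unitMass {x : ℝ} (hx : x ∈ Ioc (0 : ℝ) 1) :
    f x ≤ Real.exp K * unitMass f := by
  calc f x = ∫ _ in Ioc (0 : ℝ) 1, f x := (unitMass_const _).symm
    _ ≤ ∫ y in Ioc (0 : ℝ) 1, Real.exp K * f y :=
      setIntegral_mono_on (integrableOn_const (by simp)) (hf.1.const_mul _) measurableSet_Ioc
        fun y hy => le_exp_mul_of_mem_logHolder hK hh hf hx hy
    _ = _ := integral_const_mul _ _

lemma unitMass_le_exp_mul {x : ℝ} (hx : x ∈ Ioc (0 : ℝ) 1) :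
    unitMass f ≤ Real.exp K * f x := by
  calc unitMass f ≤ ∫ _ in Ioc (0 : ℝ) 1, Real.exp K * f x :=
      setIntegral_mono_on hf.1 (integrableOn_const (by simp)) measurableSet_Ioc
        fun y hy => le_exp_mul_of_mem_logHolder hK hh hf hy hx
    _ = _ := unitMass_const _

end logHolder

lemma smul_mem_logHolder {K h c : ℝ} (hc : 0 ≤ c) {f : ℝ → ℝ} (hf : f ∈ logHolder K h) :
    c • f ∈ logHolder K h := by
  refine ⟨hf.1.smul c, fun x hx => mul_nonneg hc (hf.2.1 x hx), fun x hx y hy => ?_⟩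
  have := mul_le_mul_of_nonneg_left (hf.2.2 x hx y hy) hc
  simp only [Pi.smul_apply, smul_eq_mul]
  linarith

lemma unitMass_smul (c : ℝ) (f : ℝ → ℝ) : unitMass (c • f) = c * unitMass f :=
  integral_const_mul _ _

lemma const_mem_logHolder {K h c : ℝ} (hK : 0 ≤ K) (hc : 0 ≤ c) : (fun _ => c) ∈ logHolder K h := by
  refine ⟨by simp, fun _ _ => hc, fun x _ y _ => ?_⟩
  exact le_mul_of_one_le_left hc (Real.one_le_exp (by positivity))

/-- Removing a small constant from a log-Hölder density. -/
lemma sub_const_mem_logHolder {K K' h c : ℝ} (hK' : 0 ≤ K') (hKK' : K' ≤ K) (hh : 0 < h)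
    {f : ℝ → ℝ} (hf : f ∈ logHolder K' h) (hc : 0 ≤ c)
    (hcf : ∀ x ∈ Ioc (0 : ℝ) 1, c * (K * Real.exp K) ≤ (K - K') * f x)
    (hcf' : ∀ x ∈ Ioc (0 : ℝ) 1, c ≤ f x) :
    f - (fun _ => c) ∈ logHolder K h := by
  refine ⟨hf.1.sub (by simp), fun x hx => sub_nonneg.2 (hcf' x hx), fun x hx y hy => ?_⟩
  have hd1 : |x - y| ^ h ≤ 1 := by
    refine Real.rpow_le_one (abs_nonneg _) ?_ hh.le
    rw [abs_le]; constructor <;> linarith [hx.1, hx.2, hy.1, hy.2]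
  have hd0 : 0 ≤ |x - y| ^ h := by positivity
  have h1 := hf.2.2 x hx y hy
  have hfy := hf.2.1 y hy
  simp only [Pi.sub_apply]
  set d := |x - y| ^ h
  have hKd : 0 ≤ K * d := mul_nonneg (hK'.trans hKK') hd0
  have e1 : (K - K') * d ≤ Real.exp (K * d) - Real.exp (K' * d) := by
    have a := Real.add_one_le_exp ((K - K') * d)
    have b : Real.exp (K * d) = Real.exp (K' * d) * Real.exp ((K - K') * d) := by
      rw [← Real.exp_add]; ring_nf
    have c1 := Real.one_le_exp (mul_nonneg hK' hd0)
    have : 0 ≤ (K - K') * d := mul_nonneg (by linarith) hd0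
    rw [b]; nlinarith
  have e2 : Real.exp (K * d) - 1 ≤ K * Real.exp K * d := by
    have a := Real.add_one_le_exp (-(K * d))
    have b : Real.exp (K * d) * Real.exp (-(K * d)) = 1 := by rw [← Real.exp_add]; simp
    have c1 := Real.exp_pos (K * d)
    have c2 : Real.exp (K * d) ≤ Real.exp K :=
      Real.exp_le_exp.2 (mul_le_of_le_one_right (hK'.trans hKK') hd1)
    nlinarith
  have e3 : c * (Real.exp (K * d) - 1) ≤ (Real.exp (K * d) - Real.exp (K' * d)) * f y :=
    calc _ ≤ c * (K * Real.exp K * d) := by gcongr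
      _ = c * (K * Real.exp K) * d := by ring
      _ ≤ (K - K') * f y * d := mul_le_mul_of_nonneg_right (hcf y hy) hd0
      _ = (K - K') * d * f y := by ring
      _ ≤ _ := mul_le_mul_of_nonneg_right e1 hfy
  linarith

/-- The set of points of `(0,1]` that stay in the left branch for times `t, …, t+k-1` is
`(0, waitPoint ω t k]`, up to its endpoint. -/
def waitPoint (ω : ℕ → ℝ) (t : ℕ) : ℕ → ℝ
  | 0 => 1
  | k + 1 => leftInv (ω t) (waitPoint ω (t + 1) k)

/-- The number of indices `i < n` with `ω i ≤ γ`. -/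
def countLE (γ : ℝ) (ω : ℕ → ℝ) (n : ℕ) : ℝ := ∑ i ∈ Finset.range n, if ω i ≤ γ then 1 else 0

lemma countLE_succ (γ : ℝ) (ω : ℕ → ℝ) (n : ℕ) :
    countLE γ ω (n + 1) = countLE γ ω n + if ω n ≤ γ then 1 else 0 := Finset.sum_range_succ _ _

lemma countLE_step (γ : ℝ) (ω : ℕ → ℝ) (n : ℕ) : countLE γ ω (n + 1) ≤ countLE γ ω n + 1 := by
  rw [countLE_succ]; split_ifs <;> linarith

lemma monotone_countLE (γ : ℝ) (ω : ℕ → ℝ) : Monotone (countLE γ ω) :=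
  monotone_nat_of_le_succ fun n => by rw [countLE_succ]; split_ifs <;> linarith

lemma countLE_of_forall_le {γ : ℝ} {ω : ℕ → ℝ} (h : ∀ i, ω i ≤ γ) (n : ℕ) : countLE γ ω n = n := by
  simp [countLE, h]

/-- One step of the escape from the neutral fixed point, in the coordinate `x ^ (-γ)`. -/
lemma rpow_neg_leftBranch_add_le {γ δ z : ℝ} (hδ : 0 < δ) (hδγ : δ ≤ γ) (hγ1 : γ ≤ 1)
    (hz : z ∈ Ioc (0 : ℝ) (1 / 2)) : leftBranch δ z ^ (-γ) + γ / 2 ≤ z ^ (-γ) := by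
  have hγ := hδ.trans_le hδγ
  have hz0 := hz.1
  have hz2 : 2 * z ≤ 1 := by linarith [hz.2]
  set w := (2 * z) ^ γ with hw
  have hw0 : 0 < w := by positivity
  have hw1 : w ≤ 1 := Real.rpow_le_one (by positivity) hz2 hγ.le
  have hle : z * (1 + w) ≤ leftBranch δ z := by
    rw [leftBranch_eq hz0.le]
    have := Real.rpow_le_rpow_of_exponent_ge (by positivity) hz2 hδγ
    gcongr
  have h1 : leftBranch δ z ^ (-γ) ≤ z ^ (-γ) * (1 + w) ^ (-γ) := by
    rw [← Real.mul_rpow hz0.le (by positivity)]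
    exact Real.rpow_le_rpow_of_nonpos (by positivity) hle (by linarith)
  have h2 : (1 + w) ^ (-γ) ≤ 1 - γ * w / 2 := by
    have e : (1 + w)⁻¹ = 1 + -(w / (1 + w)) := by field_simp; ring
    rw [Real.rpow_neg (by positivity), ← Real.inv_rpow (by positivity), e]
    have hq : w / 2 ≤ w / (1 + w) := by gcongr; linarith
    have hq1 : w / (1 + w) ≤ 1 := (div_le_one (by positivity)).2 (by linarith)
    have := rpow_one_add_le_one_add_mul_self (s := -(w / (1 + w))) (by linarith) hγ.le hγ1
    nlinarith
  have h3 : z ^ (-γ) * w = 2 ^ γ := by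
    rw [hw, Real.mul_rpow zero_le_two hz0.le, mul_left_comm, ← Real.rpow_add hz0]; simp
  have h4 : (1 : ℝ) ≤ 2 ^ γ := Real.one_le_rpow one_le_two hγ.le
  have h5 := mul_le_mul_of_nonneg_left h2 (Real.rpow_nonneg hz0.le (-γ))
  nlinarith

section waitPoint
variable {ω : ℕ → ℝ} (hω : ∀ i, 0 < ω i)
include hω

lemma waitPoint_mem (t k : ℕ) : waitPoint ω t k ∈ Ioc (0 : ℝ) 1 := by
  induction k generalizing t with
  | zero => simp [waitPoint]
  | succ k ih =>
    have := leftInv_mem (hω t) (ih (t + 1))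
    exact ⟨this.1, this.2.trans (by norm_num)⟩

lemma one_add_mul_le_waitPoint_rpow {γ : ℝ} (hγ : 0 < γ) (hγ1 : γ ≤ 1) (t k : ℕ) :
    1 + γ / 2 * (countLE γ ω (t + k) - countLE γ ω t) ≤ waitPoint ω t k ^ (-γ) := by
  induction k generalizing t with
  | zero => simp [waitPoint]
  | succ k ih =>
    have h := ih (t + 1)
    have hx := waitPoint_mem hω (t + 1) k
    have hz := leftInv_mem (hω t) hx
    rw [countLE_succ, show t + 1 + k = t + (k + 1) by ring] at h
    rw [waitPoint]
    split_ifs at h with hle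
    · have := rpow_neg_leftBranch_add_le (hω t) hle hγ1 hz
      rw [leftBranch_leftInv (hω t) hx] at this
      linarith
    · have := Real.rpow_le_rpow_of_nonpos hz.1 (leftInv_le (hω t) hx) (neg_nonpos.2 hγ.le)
      linarith

/-- Polynomial decay of the waiting points, in terms of the number of visits to `(0,γ]`. -/
lemma waitPoint_le {γ : ℝ} (hγ : 0 < γ) (hγ1 : γ ≤ 1) (t k : ℕ) :
    waitPoint ω t k ≤
      (γ / 2) ^ (-(1 / γ)) * (1 + (countLE γ ω (t + k) - countLE γ ω t)) ^ (-(1 / γ)) := by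
  have h := one_add_mul_le_waitPoint_rpow hω hγ hγ1 t k
  have hd := sub_nonneg.2 (monotone_countLE γ ω (Nat.le_add_right t k))
  have h0 := (waitPoint_mem hω t k).1
  set Δ := countLE γ ω (t + k) - countLE γ ω t
  rw [← Real.mul_rpow (by positivity) (by positivity)]
  have e : waitPoint ω t k = (waitPoint ω t k ^ (-γ)) ^ (-(1 / γ)) := by
    rw [← Real.rpow_mul h0.le]
    have : -γ * -(1 / γ) = 1 := by field_simp
    rw [this, Real.rpow_one]
  rw [e]
  refine Real.rpow_le_rpow_of_nonpos (by positivity) ?_ (neg_nonpos.2 (by positivity))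
  nlinarith

/-- The mass that has been waiting for `k` steps. -/
lemma unitMass_iterStep (t k : ℕ) (f : ℝ → ℝ) :
    unitMass (iterStep (fun i => leftTransfer (ω i)) t k f) =
      ∫ x in Ioc 0 (waitPoint ω t k), f x := by
  induction k generalizing t f with
  | zero => rfl
  | succ k ih =>
    have hx := waitPoint_mem hω (t + 1) k
    have hz := leftInv_mem (hω t) hx
    rw [iterStep_succ', ih]
    have := setIntegral_leftTransfer_mul (hω t) hz.1.le hz.2 f (fun _ => 1)
    rw [leftBranch_leftInv (hω t) hx] at this
    simpa only [mul_one, waitPoint] using this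

end waitPoint

lemma unitMass_add {f g : ℝ → ℝ} (hf : IntegrableOn f (Ioc 0 1)) (hg : IntegrableOn g (Ioc 0 1)) :
    unitMass (f + g) = unitMass f + unitMass g := integral_add hf hg

lemma unitMass_eq_add {γ : ℝ} (hγ : 0 < γ) {f : ℝ → ℝ} (hf : IntegrableOn f (Ioc 0 1)) :
    unitMass f = unitMass (leftTransfer γ f) + unitMass (rightTransfer f) := by
  simpa [unitMass] using setIntegral_mul_comp_lsv hγ f (fun _ => 1) (by simpa using hf)

lemma iterStep_leftTransfer_mem {ω : ℕ → ℝ} (hω : ∀ i, 0 < ω i) (hω1 : ∀ i, ω i ≤ 1) {K h : ℝ}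
    (hK : 0 ≤ K) (hh : 0 ≤ h) (t k : ℕ) {f : ℝ → ℝ} (hf : f ∈ admissible K h) :
    iterStep (fun i => leftTransfer (ω i)) t k f ∈ admissible K h := by
  induction k with
  | zero => exact hf
  | succ k ih => exact leftTransfer_mem_admissible (hω _) (hω1 _) hK hh ih

lemma leftTransfer_one_le {γ K h : ℝ} (hγ : 0 < γ) (hK : 0 ≤ K) (hh : 0 < h) {f : ℝ → ℝ}
    (hf : f ∈ admissible K h) : leftTransfer γ f 1 ≤ 4 * Real.exp K * f 1 := by
  have h1 := (hf.2.2 (1 / 2) 1 (by norm_num) (by norm_num) le_rfl).1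
  have f1 := hf.2.1 1 (by norm_num)
  have f2 := hf.2.1 (1 / 2) (by norm_num)
  have hE : Real.exp (K * (1 - 1 / 2) ^ h) ≤ Real.exp K :=
    Real.exp_le_exp.2 (mul_le_of_le_one_right hK
      (Real.rpow_le_one (by norm_num) (by norm_num) hh.le))
  rw [leftTransfer, leftInv_one hγ]
  refine (div_le_self f2 (one_le_leftDeriv hγ (by norm_num))).trans (h1.trans ?_)
  calc _ ≤ Real.exp K * (1 / (1 / 2)) ^ 2 * f 1 := by gcongr
    _ = _ := by ring

lemma iterStep_leftTransfer_one_le {ω : ℕ → ℝ} (hω : ∀ i, 0 < ω i) (hω1 : ∀ i, ω i ≤ 1) {K h : ℝ}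
    (hK : 0 ≤ K) (hh : 0 < h) (t k : ℕ) {f : ℝ → ℝ} (hf : f ∈ admissible K h) :
    iterStep (fun i => leftTransfer (ω i)) t k f 1 ≤ (4 * Real.exp K) ^ k * f 1 := by
  induction k with
  | zero => simp [iterStep]
  | succ k ih =>
    refine (leftTransfer_one_le (hω _) hK hh
      (iterStep_leftTransfer_mem hω hω1 hK hh.le t k hf)).trans ?_
    rw [pow_succ', mul_assoc (4 * Real.exp K)]
    exact mul_le_mul_of_nonneg_left ih (by positivity)

/-- In a bounded number of steps, a definite proportion of the mass that does not wait longer is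
renewed at once. -/
lemma exists_unitMass_le {K h : ℝ} (hK : 0 ≤ K) (hh : 0 < h) (hh1 : h ≤ 1) (k : ℕ) :
    ∃ C : ℝ, 0 < C ∧ ∀ ω : ℕ → ℝ, (∀ i, 0 < ω i) → (∀ i, ω i ≤ 1) → ∀ t, ∀ f ∈ admissible K h,
      unitMass f ≤ C * unitMass (rightTransfer f) +
        unitMass (iterStep (fun i => leftTransfer (ω i)) t k f) := by
  set K' := K * (1 / 2) ^ h + 2
  have hK' : 0 ≤ K' := by positivity
  induction k with
  | zero =>
    refine ⟨1, one_pos, fun ω hω hω1 t f hf => ?_⟩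
    have := unitMass_nonneg (rightTransfer_mem_logHolder hh1 hf).2.1
    simpa [iterStep] using this
  | succ k ih =>
    obtain ⟨C, hC, H⟩ := ih
    refine ⟨C + Real.exp K' * ((4 * Real.exp K) ^ k * Real.exp K'), by positivity,
      fun ω hω hω1 t f hf => ?_⟩
    have hg := iterStep_leftTransfer_mem hω hω1 hK hh.le t k hf
    have h1 := H ω hω hω1 t f hf
    have h2 := unitMass_eq_add (hω (t + k)) hg.1
    have h3 := unitMass_le_exp_mul hK' hh (rightTransfer_mem_logHolder hh1 hg)
      (x := 1) (by norm_num)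
    have h4 := le_exp_mul_unitMass hK' hh (rightTransfer_mem_logHolder hh1 hf)
      (x := 1) (by norm_num)
    have h5 := iterStep_leftTransfer_one_le hω hω1 hK hh t k hf
    set g := iterStep (fun i => leftTransfer (ω i)) t k f
    have h6 : rightTransfer g 1 ≤ (4 * Real.exp K) ^ k * rightTransfer f 1 := by
      simp only [rightTransfer]; norm_num; linarith
    have h7 : Real.exp K' * rightTransfer g 1 ≤ Real.exp K' * ((4 * Real.exp K) ^ k *
        (Real.exp K' * unitMass (rightTransfer f))) := by
      refine mul_le_mul_of_nonneg_left (h6.trans ?_) (by positivity)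
      exact mul_le_mul_of_nonneg_left h4 (by positivity)
    change _ ≤ _ + unitMass (leftTransfer (ω (t + k)) g)
    linarith

/-- The Doeblin decomposition of two log-Hölder densities. -/
lemma exists_doeblin {K K' h : ℝ} (hK' : 0 ≤ K') (hKK' : K' < K) (hh : 0 < h) {ε : ℝ}
    (hε : ε = Real.exp (-K') * (K - K') / (K * Real.exp K)) {f g : ℝ → ℝ}
    (hf : f ∈ logHolder K' h) (hg : g ∈ logHolder K' h) :
    ∃ G ∈ logHolder K h, unitMass g • f = G + (fun _ => ε * (unitMass f * unitMass g)) ∧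
      unitMass G = (1 - ε) * (unitMass f * unitMass g) := by
  have hK : 0 < K := hK'.trans_lt hKK'
  have mf := unitMass_nonneg hf.2.1
  have mg := unitMass_nonneg hg.2.1
  have hε0 : 0 ≤ ε := hε ▸ by have := sub_pos.2 hKK'; positivity
  set M := unitMass f * unitMass g with hM
  have hM0 : 0 ≤ M := mul_nonneg mf mg
  have hMf : ∀ x ∈ Ioc (0 : ℝ) 1, Real.exp (-K') * M ≤ (unitMass g • f) x := fun x hx => by
    have := unitMass_le_exp_mul hK' hh hf hx
    rw [Real.exp_neg, inv_mul_le_iff₀ (Real.exp_pos _)]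
    simp only [Pi.smul_apply, smul_eq_mul]
    calc M ≤ Real.exp K' * f x * unitMass g := mul_le_mul_of_nonneg_right this mg
      _ = _ := by ring
  have hεe : ε ≤ Real.exp (-K') := by
    rw [hε, div_le_iff₀ (by positivity)]
    refine mul_le_mul_of_nonneg_left ?_ (Real.exp_pos _).le
    nlinarith [Real.one_le_exp hK.le]
  have hcf : ∀ x ∈ Ioc (0 : ℝ) 1, ε * M * (K * Real.exp K) ≤ (K - K') * (unitMass g • f) x :=
    fun x hx => by
      have := mul_le_mul_of_nonneg_left (hMf x hx) (sub_pos.2 hKK').le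
      refine le_trans (le_of_eq ?_) this
      rw [hε]; field_simp
  refine ⟨_, sub_const_mem_logHolder hK' hKK'.le hh (smul_mem_logHolder mg hf)
    (mul_nonneg hε0 hM0) hcf fun x hx =>
      (mul_le_mul_of_nonneg_right hεe hM0).trans (hMf x hx), ?_, ?_⟩
  · rw [sub_add_cancel]
  · have : unitMass (unitMass g • f - fun _ => ε * M) = unitMass (unitMass g • f) - ε * M := by
      rw [unitMass, integral_sub' (hf.1.smul _) (integrableOn_const (by simp))]
      congr 1; exact unitMass_const _
    rw [this, unitMass_smul, hM]; ring

lemma doeblin_const_pos {K K' : ℝ} (hK' : 0 ≤ K') (hKK' : K' < K) :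
    0 < Real.exp (-K') * (K - K') / (K * Real.exp K) := by
  have := sub_pos.2 hKK'
  have : 0 < K := hK'.trans_lt hKK'
  positivity

lemma doeblin_const_lt_one {K L : ℝ} (hL : 0 ≤ L) (hLK : L < K) :
    Real.exp (-L) * (K - L) / (K * Real.exp K) < 1 := by
  have hK : 0 < K := hL.trans_lt hLK
  rw [div_lt_one (by positivity)]
  have h1 : Real.exp (-L) ≤ 1 := Real.exp_le_one_iff.2 (by linarith)
  have h2 : 1 < Real.exp K := Real.one_lt_exp_iff.2 hK
  nlinarith [Real.exp_pos (-L)]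

/-- The transfer operators of a sequence of maps `lsv (ω i)`, on log-Hölder densities. -/
def lsvScheme (ω : ℕ → ℝ) (hω : ∀ i, 0 < ω i) (hω1 : ∀ i, ω i ≤ 1) (K h : ℝ) (hK0 : 0 ≤ K)
    (hK : K * (1 / 2) ^ h + 2 < K) (hh : 0 < h) (hh1 : h ≤ 1) : TransferScheme (ℝ → ℝ) where
  W := admissible K h
  D := logHolder K h
  D' := logHolder (K * (1 / 2) ^ h + 2) h
  A i := leftTransfer (ω i)
  B := rightTransfer
  mass := unitMass
  ε := Real.exp (-(K * (1 / 2) ^ h + 2)) * (K - (K * (1 / 2) ^ h + 2)) / (K * Real.exp K)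
  β t k := Real.exp K * waitPoint ω t k
  D_subset := logHolder_subset_admissible
  D'_subset := logHolder_mono hK.le
  A_mem t _ hf := leftTransfer_mem_admissible (hω t) (hω1 t) hK0 hh.le hf
  B_mem _ hf := rightTransfer_mem_logHolder hh1 hf
  add_mem _ _ hf hg := admissible_add hf hg
  A_add t f g := by ext x; exact add_div _ _ _
  mass_nonneg _ hf := unitMass_nonneg hf.2.1
  mass_add _ _ hf hg := unitMass_add hf.1 hg.1
  mass_split t _ hf := unitMass_eq_add (hω t) hf.1
  ε_pos := doeblin_const_pos (by positivity) hK
  ε_lt_one := doeblin_const_lt_one (by positivity) hK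
  doeblin f g hf hg := by
    obtain ⟨G₀, h₀, e₀, m₀⟩ := exists_doeblin (by positivity) hK hh rfl hf hg
    obtain ⟨G₁, h₁, e₁, m₁⟩ := exists_doeblin (by positivity) hK hh rfl hg hf
    rw [mul_comm (unitMass g)] at e₁ m₁
    refine ⟨G₀, h₀, G₁, h₁, _, logHolder_subset_admissible (const_mem_logHolder hK0 ?_),
      e₀, e₁, m₀, m₁⟩
    exact mul_nonneg (doeblin_const_pos (by positivity) hK).le
      (mul_nonneg (unitMass_nonneg hf.2.1) (unitMass_nonneg hg.2.1))
  lower k := by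
    obtain ⟨C, hC, H⟩ := exists_unitMass_le hK0 hh hh1 k
    exact ⟨C, hC, fun t f hf => H ω hω hω1 t f hf⟩
  β_nonneg t k := mul_nonneg (Real.exp_pos _).le (waitPoint_mem hω t k).1.le
  tail t k f hf := by
    rw [unitMass_iterStep hω]
    have hw := waitPoint_mem hω t k
    have hsub : Ioc 0 (waitPoint ω t k) ⊆ Ioc (0 : ℝ) 1 := Ioc_subset_Ioc_right hw.2
    calc _ ≤ ∫ _ in Ioc 0 (waitPoint ω t k), Real.exp K * unitMass f :=
        setIntegral_mono_on (hf.1.mono_set hsub) (integrableOn_const (by simp)) measurableSet_Ioc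
          fun x hx => le_exp_mul_unitMass hK0 hh hf (hsub hx)
      _ = _ := by
        rw [setIntegral_const]; simp [hw.1.le]; ring

lemma integrableOn_mul_indicator_comp {f T : ℝ → ℝ} (hf : IntegrableOn f (Ioc 0 1))
    (hT : Measurable T) {s : Set ℝ} (hs : MeasurableSet s) :
    IntegrableOn (fun x => f x * s.indicator 1 (T x)) (Ioc 0 1) := by
  have : (fun x => f x * s.indicator 1 (T x)) = (T ⁻¹' s).indicator f := by
    ext x
    by_cases hx : T x ∈ s <;> simp [hx]
  rw [this]
  exact hf.indicator (hT hs)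

/-- The indicator of a measurable set at time `N`, as an observable. -/
def lsvObservable {ω : ℕ → ℝ} (hω : ∀ i, 0 < ω i) (hω1 : ∀ i, ω i ≤ 1) {K h : ℝ} (hK0 : 0 ≤ K)
    (hK : K * (1 / 2) ^ h + 2 < K) (hh : 0 < h) (hh1 : h ≤ 1) (N : ℕ) {s : Set ℝ}
    (hs : MeasurableSet s) : (lsvScheme ω hω hω1 K h hK0 hK hh hh1).Observable N where
  e t f := ∫ x in Ioc 0 1, f x * s.indicator 1 (seqComp (fun i => lsv (ω i)) t (N - t) x)
  nonneg t f hf := setIntegral_nonneg measurableSet_Ioc fun x hx =>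
    mul_nonneg (hf.2.1 x hx) (indicator_nonneg (fun _ _ => zero_le_one) _)
  le_mass t f hf := setIntegral_mono_on
    (integrableOn_mul_indicator_comp hf.1 (measurable_seqComp_lsv ω t (N - t)) hs) hf.1
    measurableSet_Ioc fun x hx => mul_le_of_le_one_right (hf.2.1 x hx)
      (indicator_le' (fun _ _ => le_rfl) (fun _ _ => zero_le_one) _)
  add t f g hf hg := by
    have hT := measurable_seqComp_lsv ω t (N - t)
    rw [← integral_add (integrableOn_mul_indicator_comp hf.1 hT hs)
      (integrableOn_mul_indicator_comp hg.1 hT hs)]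
    simp only [Pi.add_apply, add_mul]
  smul t c f := by
    rw [← integral_const_mul]; congr 1; ext x; simp only [Pi.smul_apply, smul_eq_mul]; ring
  split t f ht hf := by
    have hi := integrableOn_mul_indicator_comp hf.1 (measurable_seqComp_lsv ω t (N - t)) hs
    obtain ⟨n, hn⟩ : ∃ n, N - t = n + 1 := ⟨N - t - 1, by omega⟩
    rw [show N - (t + 1) = n by omega]
    simp only [hn, seqComp_succ'] at hi ⊢
    exact setIntegral_mul_comp_lsv (hω t) f
      (fun x => s.indicator 1 (seqComp (fun i => lsv (ω i)) (t + 1) n x)) hi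

lemma summable_one_add_rpow {p : ℝ} (hp : 1 < p) : Summable fun k : ℕ => (1 + k : ℝ) ^ (-p) := by
  have := (summable_nat_add_iff 1).2 (Real.summable_nat_rpow.2 (neg_lt_neg hp))
  refine this.congr fun k => ?_
  push_cast; rw [add_comm]

lemma lsvScheme_tailBounds {ω : ℕ → ℝ} (hω : ∀ i, 0 < ω i) (hω1 : ∀ i, ω i ≤ 1) {K h : ℝ}
    (hK0 : 0 ≤ K) (hK : K * (1 / 2) ^ h + 2 < K) (hh : 0 < h) (hh1 : h ≤ 1) {γ γ' : ℝ}
    (hγ : 0 < γ) (hγ1 : γ ≤ 1) (hγ' : 0 < γ') (hγ'1 : γ' < 1) (hωγ' : ∀ i, ω i ≤ γ') :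
    (lsvScheme ω hω hω1 K h hK0 hK hh hh1).TailBounds (countLE γ ω) (1 / γ)
      (fun k => Real.exp K * ((γ' / 2) ^ (-(1 / γ')) * (1 + k : ℝ) ^ (-(1 / γ'))))
      (Real.exp K * (γ / 2) ^ (-(1 / γ))) where
  α_pos := by positivity
  Ct_nonneg := by positivity
  mono := monotone_countLE γ ω
  step := countLE_step γ ω
  summable := ((summable_one_add_rpow ((one_lt_div hγ').2 hγ'1)).mul_left _).mul_left _
  le_b t k := by
    refine mul_le_mul_of_nonneg_left ?_ (Real.exp_pos _).le
    have := waitPoint_le hω hγ' hγ'1.le t k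
    rw [countLE_of_forall_le hωγ', countLE_of_forall_le hωγ'] at this
    simpa using this
  le_rpow t k := by
    rw [mul_assoc]
    exact mul_le_mul_of_nonneg_left (waitPoint_le hω hγ hγ1 t k) (Real.exp_pos _).le

/-- `μ` has the density `f` on `[0,1]`. -/
structure HasUnitDensity (μ : Measure ℝ) (f : ℝ → ℝ) : Prop where
  integrable : IntegrableOn f (Ioc 0 1)
  nonneg : ∀ x ∈ Ioc (0 : ℝ) 1, 0 ≤ f x
  eq : μ = (volume.restrict (Icc 0 1)).withDensity fun x => ENNReal.ofReal (f x)

namespace HasUnitDensity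
variable {μ : Measure ℝ} {f : ℝ → ℝ} (hf : HasUnitDensity μ f)
include hf

lemma toReal_map {T : ℝ → ℝ} (hT : Measurable T) {s : Set ℝ} (hs : MeasurableSet s) :
    (μ.map T s).toReal = ∫ x in Ioc 0 1, f x * s.indicator 1 (T x) := by
  have h1 : (fun x => f x * s.indicator 1 (T x)) = (T ⁻¹' s).indicator f := by
    ext x
    by_cases hx : T x ∈ s <;> simp [hx]
  have hms := hT hs
  have hi : Integrable f ((volume.restrict (Ioc 0 1)).restrict (T ⁻¹' s)) :=
    Integrable.restrict hf.integrable
  rw [Measure.map_apply hT hs, hf.eq, withDensity_apply _ hms, h1, integral_indicator hms,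
    integral_eq_lintegral_of_nonneg_ae _ hi.1, Measure.restrict_congr_set Ioc_ae_eq_Icc]
  exact ae_restrict_of_ae ((ae_restrict_iff' measurableSet_Ioc).2 (ae_of_all _ hf.nonneg))

lemma unitMass_eq [IsProbabilityMeasure μ] : unitMass f = 1 := by
  have := hf.toReal_map measurable_id (s := univ) MeasurableSet.univ
  simpa [unitMass] using this.symm

lemma unitMass_add_one [IsProbabilityMeasure μ] : unitMass (f + fun _ => 1) = 2 := by
  rw [unitMass_add hf.integrable (integrableOn_const (by simp)), hf.unitMass_eq, unitMass_const]
  norm_num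

lemma toReal_map_sub {μ' : Measure ℝ} {f' : ℝ → ℝ} (hf' : HasUnitDensity μ' f') {T : ℝ → ℝ}
    (hT : Measurable T) {s : Set ℝ} (hs : MeasurableSet s) :
    (μ.map T s).toReal - (μ'.map T s).toReal =
      (∫ x in Ioc 0 1, (f + (fun _ => 1) : ℝ → ℝ) x * s.indicator 1 (T x)) -
        ∫ x in Ioc 0 1, (f' + (fun _ => 1) : ℝ → ℝ) x * s.indicator 1 (T x) := by
  have h1 : IntegrableOn (fun _ : ℝ => (1 : ℝ)) (Ioc 0 1) := integrableOn_const (by simp)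
  have h2 := integrableOn_mul_indicator_comp h1 hT hs
  simp only [Pi.add_apply, add_mul (_ : ℝ) 1]
  rw [integral_add (integrableOn_mul_indicator_comp hf.integrable hT hs) h2,
    integral_add (integrableOn_mul_indicator_comp hf'.integrable hT hs) h2,
    hf.toReal_map hT hs, hf'.toReal_map hT hs]
  ring

end HasUnitDensity

/-- Adding a constant to a Hölder density makes it log-Hölder. -/
lemma HolderDensityOn.exists_logHolder {μ : Measure ℝ} (hμ : HolderDensityOn (Icc 0 1) μ) :
    ∃ f, HasUnitDensity μ f ∧ ∃ C r : ℝ, 0 ≤ C ∧ 0 < r ∧ r ≤ 1 ∧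
      ∀ K h, C ≤ K → h ≤ r → (f + fun _ => 1) ∈ logHolder K h := by
  obtain ⟨f, hf0, ⟨C, r, hr, hr1, hC⟩, rfl⟩ := hμ
  have hcont : ContinuousOn f (Icc 0 1) := hC.continuousOn hr
  have hint : IntegrableOn f (Ioc 0 1) :=
    (hcont.integrableOn_Icc (μ := volume)).mono_set Ioc_subset_Icc_self
  refine ⟨f, ⟨hint, fun x _ => hf0 x, rfl⟩, C, r, C.2, hr, hr1, fun K h hK hh => ?_⟩
  refine ⟨hint.add (integrableOn_const (by simp)), fun x _ => add_nonneg (hf0 x) zero_le_one,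
    fun x hx y hy => ?_⟩
  have h1 := hC.dist_le (Ioc_subset_Icc_self hx) (Ioc_subset_Icc_self hy)
  rw [Real.dist_eq, Real.dist_eq] at h1
  have hd1 : |x - y| ≤ 1 := by
    rw [abs_le]; constructor <;> linarith [hx.1, hx.2, hy.1, hy.2]
  have h2 : (C : ℝ) * |x - y| ^ (r : ℝ) ≤ K * |x - y| ^ h := by
    rcases (abs_nonneg (x - y)).eq_or_lt with h0 | h0
    · rw [← h0, Real.zero_rpow (by positivity), mul_zero]
      exact mul_nonneg (C.2.trans hK) (Real.rpow_nonneg le_rfl _)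
    · exact mul_le_mul hK (Real.rpow_le_rpow_of_exponent_ge h0 hd1 hh) (by positivity)
        (C.2.trans hK)
  have h3 := Real.add_one_le_exp (K * |x - y| ^ h)
  have h4 := hf0 y
  have h5 : 0 ≤ K * |x - y| ^ h := mul_nonneg (C.2.trans hK) (by positivity)
  have h6 := (abs_le.1 h1).2
  simp only [Pi.add_apply]
  nlinarith

/-- Densities in the cone `C_*(γ)` are admissible. -/
lemma memConeStar.add_one_mem_admissible {γ aβ : ℝ} (hγ1 : γ ≤ 1) {f : ℝ → ℝ}
    (hf : memConeStar γ aβ f) {K h : ℝ} (hK : 0 ≤ K) : (f + fun _ => 1) ∈ admissible K h := by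
  obtain ⟨-, hint, h0, hanti, hmono, -⟩ := hf
  refine ⟨hint.add (integrableOn_const (by simp)), fun x hx => add_nonneg (h0 x hx) zero_le_one,
    fun x y hx hxy hy => ?_⟩
  have hy0 := hx.trans_le hxy
  have hx' : x ∈ Ioc (0 : ℝ) 1 := ⟨hx, hxy.trans hy⟩
  have hy' : y ∈ Ioc (0 : ℝ) 1 := ⟨hy0, hy⟩
  have a := hanti hx' hy' hxy
  have b : x ^ (γ + 1) * f x ≤ y ^ (γ + 1) * f y := hmono hx' hy' hxy
  have fx := h0 x hx'
  have fy := h0 y hy'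
  have hr : 1 ≤ y / x := (one_le_div hx).2 hxy
  have hr2 : 1 ≤ (y / x) ^ 2 := one_le_pow₀ hr
  have hE : 1 ≤ Real.exp (K * (y - x) ^ h) :=
    Real.one_le_exp (mul_nonneg hK (Real.rpow_nonneg (by linarith) _))
  have hP : (y / x) ^ 2 ≤ Real.exp (K * (y - x) ^ h) * (y / x) ^ 2 :=
    le_mul_of_one_le_left (by positivity) hE
  have hb : f x ≤ (y / x) ^ 2 * f y := by
    have h1 : f x ≤ (y / x) ^ (γ + 1) * f y := by
      rw [Real.div_rpow hy0.le hx.le, div_mul_eq_mul_div, le_div_iff₀ (by positivity)]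
      linarith
    refine h1.trans (mul_le_mul_of_nonneg_right ?_ fy)
    rw [← Real.rpow_two]
    exact Real.rpow_le_rpow_of_exponent_le hr (by linarith)
  simp only [Pi.add_apply]
  constructor <;> nlinarith

lemma ConeDensity.exists_density {γ aβ : ℝ} {ν : Measure ℝ} (hν : ConeDensity γ aβ ν) :
    ∃ g, HasUnitDensity ν g ∧ memConeStar γ aβ g := by
  obtain ⟨g, hg, rfl⟩ := hν
  exact ⟨g, ⟨hg.2.1, hg.2.2.1, rfl⟩, hg⟩

lemma setIntegral_rpow_neg {γ a : ℝ} (hγ1 : γ < 1) (ha : 0 ≤ a) :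
    IntegrableOn (fun x : ℝ => x ^ (-γ)) (Ioc 0 a) ∧
      ∫ x in Ioc 0 a, x ^ (-γ) = a ^ (1 - γ) / (1 - γ) := by
  constructor
  · exact (intervalIntegrable_iff_integrableOn_Ioc_of_le ha).1
      (intervalIntegral.intervalIntegrable_rpow' (by linarith))
  · rw [← intervalIntegral.integral_of_le ha, integral_rpow (Or.inl (by linarith)),
      Real.zero_rpow (by linarith), sub_zero, neg_add_eq_sub]

/-- A density in the cone `C_*(γ)` has small mass near the neutral fixed point. -/
lemma memConeStar.setIntegral_add_one_le {γ aβ a : ℝ} (hγ : 0 ≤ γ) (hγ1 : γ < 1) {f : ℝ → ℝ}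
    (hf : memConeStar γ aβ f) (hmass : unitMass f = 1) (ha : a ∈ Ioc (0 : ℝ) 1) :
    ∫ x in Ioc 0 a, (f + (fun _ => 1) : ℝ → ℝ) x ≤ (aβ + 1) * (a ^ (1 - γ) / (1 - γ)) := by
  obtain ⟨hi, he⟩ := setIntegral_rpow_neg hγ1 ha.1.le
  have hsub : Ioc 0 a ⊆ Ioc (0 : ℝ) 1 := Ioc_subset_Ioc_right ha.2
  rw [← he, ← integral_const_mul]
  refine setIntegral_mono_on ((hf.2.1.mono_set hsub).add (integrableOn_const (by simp)))
    (hi.const_mul _) measurableSet_Ioc fun x hx => ?_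
  have h1 := hf.2.2.2.2.2 x (hsub hx)
  have h2 : 1 ≤ x ^ (-γ) :=
    Real.one_le_rpow_of_pos_of_le_one_of_nonpos hx.1 (hsub hx).2 (by linarith)
  rw [unitMass] at hmass
  rw [hmass, mul_one] at h1
  simp only [Pi.add_apply]
  linarith

lemma tvDist_le {X : Type*} [MeasurableSpace X] {μ ν : Measure X} {c : ℝ}
    (h : ∀ s, MeasurableSet s → |(μ s).toReal - (ν s).toReal| ≤ c) : tvDist μ ν ≤ c :=
  haveI : Nonempty { s : Set X // MeasurableSet s } := ⟨⟨∅, MeasurableSet.empty⟩⟩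
  ciSup_le fun s => h s.1 s.2

lemma tvDist_le_one {X : Type*} [MeasurableSpace X] (μ ν : Measure X) [IsProbabilityMeasure μ]
    [IsProbabilityMeasure ν] : tvDist μ ν ≤ 1 := by
  refine tvDist_le fun s _ => ?_
  have h1 : μ.real s ≤ 1 := measureReal_le_one
  have h2 : ν.real s ≤ 1 := measureReal_le_one
  have h3 : 0 ≤ μ.real s := measureReal_nonneg
  have h4 : 0 ≤ ν.real s := measureReal_nonneg
  simp only [Measure.real] at *
  rw [abs_le]; constructor <;> linarith

/-- An eventual polynomial bound on a sequence bounded by `1` gives a global one. -/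
lemma exists_le_mul_rpow {d : ℕ → ℝ} {C p x₀ : ℝ} (hd : ∀ n, d n ≤ 1) (hC : 0 ≤ C) (hp : p ≤ 0)
    (h : ∀ n : ℕ, 1 ≤ n → x₀ ≤ n → d n ≤ C * (n : ℝ) ^ p) :
    ∃ C : ℝ, ∀ n : ℕ, 1 ≤ n → d n ≤ C * (n : ℝ) ^ p := by
  obtain ⟨n₀, hn₀⟩ := exists_nat_ge (max x₀ 1)
  have h1 : 1 ≤ (n₀ : ℝ) := (le_max_right _ _).trans hn₀
  refine ⟨C + (n₀ : ℝ) ^ (-p), fun n hn => ?_⟩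
  have hn1 : (1 : ℝ) ≤ n := by exact_mod_cast hn
  have hnp : 0 ≤ (n : ℝ) ^ p := by positivity
  have hn₀p : 0 ≤ (n₀ : ℝ) ^ (-p) := by positivity
  rw [add_mul]
  rcases le_total x₀ n with hx | hx
  · exact (h n hn hx).trans (le_add_of_nonneg_right (mul_nonneg hn₀p hnp))
  · have hle : (n : ℝ) ≤ n₀ := hx.trans ((le_max_left _ _).trans hn₀)
    have := Real.rpow_le_rpow_of_nonpos (by positivity) hle hp
    have h2 : (n₀ : ℝ) ^ (-p) * (n₀ : ℝ) ^ p = 1 := by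
      rw [← Real.rpow_add (by positivity)]; simp
    have h3 := mul_le_mul_of_nonneg_left this hn₀p
    linarith [hd n, mul_nonneg hC hnp]

lemma exists_logHolder_const {h : ℝ} (hh : 0 < h) {C : ℝ} (hC : 0 ≤ C) :
    ∃ K, 0 ≤ K ∧ C ≤ K ∧ K * (1 / 2) ^ h + 2 < K := by
  have h1 : ((1 : ℝ) / 2) ^ h < 1 := Real.rpow_lt_one (by norm_num) (by norm_num) hh
  have h2 : 0 < 1 - ((1 : ℝ) / 2) ^ h := sub_pos.2 h1
  refine ⟨C + 3 / (1 - (1 / 2) ^ h), by positivity, le_add_of_nonneg_right (by positivity), ?_⟩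
  have h3 : 3 / (1 - ((1 : ℝ) / 2) ^ h) * (1 - (1 / 2) ^ h) = 3 := div_mul_cancel₀ _ h2.ne'
  nlinarith [mul_nonneg hC h2.le]

lemma measurable_lsvComp (ω : ℕ → ℝ) (n : ℕ) : Measurable (lsvComp ω n) :=
  measurable_seqComp_lsv ω 0 n

section
variable {ω : ℕ → ℝ} {γ γ' c C₀ : ℝ} (hω : ∀ i, 0 < ω i) (hωγ' : ∀ i, ω i ≤ γ') (hγ'1 : γ' < 1)
  (hγ : 0 < γ) (hγγ' : γ ≤ γ') (hc : 0 < c) (hcount : ∀ n : ℕ, c * n - C₀ ≤ countLE γ ω n)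
include hω hωγ' hγ'1 hγ hγγ' hc hcount

/-- Memory loss along a fixed sequence of parameters, for Hölder densities. -/
lemma exists_tvDist_le_of_holder {μ μ' : Measure ℝ} [IsProbabilityMeasure μ]
    [IsProbabilityMeasure μ'] (hμ : HolderDensityOn (Icc 0 1) μ)
    (hμ' : HolderDensityOn (Icc 0 1) μ') : ∃ C : ℝ, ∀ n : ℕ, 1 ≤ n →
      tvDist (μ.map (lsvComp ω n)) (μ'.map (lsvComp ω n)) ≤ C * (n : ℝ) ^ (-1 / γ) := by
  obtain ⟨f, hf, Cf, r, hCf, hr, hr1, hfK⟩ := hμ.exists_logHolder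
  obtain ⟨f', hf', Cf', r', hCf', hr', hr'1, hfK'⟩ := hμ'.exists_logHolder
  have hh : 0 < min r r' := lt_min hr hr'
  obtain ⟨K, hK0, hCK, hK⟩ := exists_logHolder_const hh (add_nonneg hCf hCf')
  have hω1 : ∀ i, ω i ≤ 1 := fun i => (hωγ' i).trans hγ'1.le
  have hh1 : min r r' ≤ 1 := (min_le_left _ _).trans hr1
  obtain ⟨C, hC⟩ := (lsvScheme_tailBounds hω hω1 hK0 hK hh hh1 hγ (hγγ'.trans hγ'1.le)
    (hγ.trans_le hγγ') hγ'1 hωγ').exists_abs_sub_le_of_mem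
  have hm := hfK K _ (by linarith) (min_le_left r r')
  have hm' := hfK' K _ (by linarith) (min_le_right r r')
  have hpr : ∀ n, IsProbabilityMeasure (μ.map (lsvComp ω n)) := fun n =>
    Measure.isProbabilityMeasure_map (measurable_lsvComp ω n).aemeasurable
  have hpr' : ∀ n, IsProbabilityMeasure (μ'.map (lsvComp ω n)) := fun n =>
    Measure.isProbabilityMeasure_map (measurable_lsvComp ω n).aemeasurable
  rw [neg_div]
  have hα : 0 < 1 / γ := by positivity
  refine exists_le_mul_rpow (C := 2 * |C| * (c / 2) ^ (-(1 / γ))) (x₀ := 2 * C₀ / c)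
    (fun n => tvDist_le_one _ _) (by positivity) (neg_nonpos.2 hα.le)
    fun n hn hnx => tvDist_le fun s hs => ?_
  have hn1 : (1 : ℝ) ≤ n := by exact_mod_cast hn
  have hS : c / 2 * n ≤ countLE γ ω n := by
    rw [div_le_iff₀ hc] at hnx
    linarith [hcount n]
  have hS0 : countLE γ ω 0 = 0 := by simp [countLE]
  have key := hC n (lsvObservable hω hω1 hK0 hK hh hh1 n hs)
    (by rw [hS0, sub_zero]; exact lt_of_lt_of_le (by positivity) hS) _ hm' _ hm
  change |unitMass _ *
    (∫ x in Ioc 0 1, (f + (fun _ => 1) : ℝ → ℝ) x * s.indicator 1 (lsvComp ω n x)) -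
    unitMass _ * ∫ x in Ioc 0 1, (f' + (fun _ => 1) : ℝ → ℝ) x * s.indicator 1 (lsvComp ω n x)| ≤
    _ * (unitMass _ * unitMass _) at key
  rw [hf.unitMass_add_one, hf'.unitMass_add_one, ← mul_sub, hS0, sub_zero,
    ← hf.toReal_map_sub hf' (measurable_lsvComp ω n) hs, abs_mul, abs_two] at key
  have h1 : countLE γ ω n ^ (-(1 / γ)) ≤ (c / 2) ^ (-(1 / γ)) * (n : ℝ) ^ (-(1 / γ)) := by
    rw [← Real.mul_rpow (by positivity) (by positivity)]
    exact Real.rpow_le_rpow_of_nonpos (by positivity) hS (neg_nonpos.2 hα.le)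
  have h2 : C * countLE γ ω n ^ (-(1 / γ)) ≤
      |C| * ((c / 2) ^ (-(1 / γ)) * (n : ℝ) ^ (-(1 / γ))) :=
    mul_le_mul (le_abs_self C) h1 (Real.rpow_nonneg (le_trans (by positivity) hS) _)
      (abs_nonneg C)
  linarith

/-- Memory loss along a fixed sequence of parameters, for a Hölder density and a density in the
cone `C_*(γ)`. -/
lemma exists_tvDist_le_of_cone {μ ν : Measure ℝ} [IsProbabilityMeasure μ]
    [IsProbabilityMeasure ν] {aβ : ℝ} (haβ : 0 ≤ aβ) (hμ : HolderDensityOn (Icc 0 1) μ)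
    (hν : ConeDensity γ aβ ν) : ∃ C : ℝ, ∀ n : ℕ, 1 ≤ n →
      tvDist (μ.map (lsvComp ω n)) (ν.map (lsvComp ω n)) ≤ C * (n : ℝ) ^ (-1 / γ + 1) := by
  obtain ⟨f, hf, Cf, h, hCf, hh, hh1, hfK⟩ := hμ.exists_logHolder
  obtain ⟨g, hg, hgcone⟩ := hν.exists_density
  obtain ⟨K, hK0, hCK, hK⟩ := exists_logHolder_const hh hCf
  have hω1 : ∀ i, ω i ≤ 1 := fun i => (hωγ' i).trans hγ'1.le
  have hγ1 := hγγ'.trans_lt hγ'1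
  obtain ⟨C, η, hC0, hη, hC⟩ := (lsvScheme_tailBounds hω hω1 hK0 hK hh hh1 hγ hγ1.le
    (hγ.trans_le hγγ') hγ'1 hωγ').exists_abs_sub_le
  have hm := hfK K h hCK le_rfl
  have hmg : (g + fun _ => 1) ∈ admissible K h := hgcone.add_one_mem_admissible hγ1.le hK0
  have hpr : ∀ n, IsProbabilityMeasure (μ.map (lsvComp ω n)) := fun n =>
    Measure.isProbabilityMeasure_map (measurable_lsvComp ω n).aemeasurable
  have hpr' : ∀ n, IsProbabilityMeasure (ν.map (lsvComp ω n)) := fun n =>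
    Measure.isProbabilityMeasure_map (measurable_lsvComp ω n).aemeasurable
  rw [neg_div]
  have hα : 1 < 1 / γ := (one_lt_div hγ).2 hγ1
  have h1γ : 0 < 1 - γ := by linarith
  have hγ2 : 0 ≤ (γ / 2) ^ (-(1 / γ)) := by positivity
  refine exists_le_mul_rpow (C := C * (c / 2) ^ (-(1 / γ)) * 2 + (aβ + 1) / (1 - γ) *
    (((γ / 2) ^ (-(1 / γ))) ^ (1 - γ) * (η * (c / 2)) ^ (-(1 / γ) + 1))) (x₀ := 2 * C₀ / c)
    (fun n => tvDist_le_one _ _) (by positivity) (by linarith)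
    fun n hn hnx => tvDist_le fun s hs => ?_
  have hn1 : (1 : ℝ) ≤ n := by exact_mod_cast hn
  have hn0 : (0 : ℝ) < n := by linarith
  have hS : c / 2 * n ≤ countLE γ ω n := by
    rw [div_le_iff₀ hc] at hnx
    linarith [hcount n]
  have hS0 : countLE γ ω 0 = 0 := by simp [countLE]
  obtain ⟨J, hJ, key⟩ := hC n (lsvObservable hω hω1 hK0 hK hh hh1 n hs)
    (by rw [hS0, sub_zero]; exact lt_of_lt_of_le (by positivity) hS) _ hmg _ hm
  change |unitMass _ *
    (∫ x in Ioc 0 1, (g + (fun _ => 1) : ℝ → ℝ) x * s.indicator 1 (lsvComp ω n x)) -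
    unitMass _ * ∫ x in Ioc 0 1, (f + (fun _ => 1) : ℝ → ℝ) x * s.indicator 1 (lsvComp ω n x)| ≤
    unitMass _ * (_ * unitMass _ + unitMass (iterStep (fun i => leftTransfer (ω i)) 0 J _)) at key
  rw [hf.unitMass_add_one, hg.unitMass_add_one, ← mul_sub, hS0, sub_zero,
    ← hg.toReal_map_sub hf (measurable_lsvComp ω n) hs, abs_mul, abs_two, abs_sub_comm,
    unitMass_iterStep hω] at key
  rw [hS0, sub_zero, sub_zero] at hJ
  have ha := waitPoint_mem hω 0 J
  have h1 : countLE γ ω n ^ (-(1 / γ)) ≤ (c / 2) ^ (-(1 / γ)) * (n : ℝ) ^ (-(1 / γ)) := by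
    rw [← Real.mul_rpow (by positivity) (by positivity)]
    exact Real.rpow_le_rpow_of_nonpos (by positivity) hS (by linarith)
  have h2 : C * n * countLE γ ω n ^ (-(1 / γ)) ≤
      C * (c / 2) ^ (-(1 / γ)) * (n : ℝ) ^ (-(1 / γ) + 1) := by
    rw [Real.rpow_add_one hn0.ne']
    have := mul_le_mul_of_nonneg_left h1 (mul_nonneg hC0 hn0.le)
    linarith
  have h3 : waitPoint ω 0 J ^ (1 - γ) ≤ ((γ / 2) ^ (-(1 / γ))) ^ (1 - γ) *
      ((η * (c / 2)) ^ (-(1 / γ) + 1) * (n : ℝ) ^ (-(1 / γ) + 1)) := by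
    have hw := waitPoint_le hω hγ hγ1.le 0 J
    rw [zero_add, hS0, sub_zero] at hw
    have hz : η * (c / 2) * n ≤ 1 + countLE γ ω J := by
      have := mul_le_mul_of_nonneg_left hS hη.le
      linarith
    have hz0 : 0 < η * (c / 2) * n := by positivity
    refine (Real.rpow_le_rpow ha.1.le hw h1γ.le).trans ?_
    rw [Real.mul_rpow hγ2 (Real.rpow_nonneg (hz0.le.trans hz) _),
      ← Real.rpow_mul (hz0.le.trans hz), ← Real.mul_rpow (by positivity) hn0.le,
      show -(1 / γ) * (1 - γ) = -(1 / γ) + 1 by field_simp; ring]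
    exact mul_le_mul_of_nonneg_left (Real.rpow_le_rpow_of_nonpos hz0 hz (by linarith))
      (by positivity)
  have h4 := hgcone.setIntegral_add_one_le hγ.le hγ1 hg.unitMass_eq ha
  have h5 : (aβ + 1) * (waitPoint ω 0 J ^ (1 - γ) / (1 - γ)) ≤ (aβ + 1) / (1 - γ) *
      (((γ / 2) ^ (-(1 / γ))) ^ (1 - γ) *
      ((η * (c / 2)) ^ (-(1 / γ) + 1) * (n : ℝ) ^ (-(1 / γ) + 1))) := by
    rw [mul_div_left_comm, mul_comm]
    exact mul_le_mul_of_nonneg_left h3 (by positivity)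
  linarith

end

lemma iterate_shift_apply (ω : ℕ → ℝ) (k n : ℕ) : shift^[k] ω n = ω (n + k) := by
  induction k generalizing ω with
  | zero => rfl
  | succ k ih => rw [Function.iterate_succ_apply, ih, shift, add_assoc]

lemma birkhoffSum_shift (γ : ℝ) (ω : ℕ → ℝ) (n : ℕ) :
    birkhoffSum shift ({ω : ℕ → ℝ | ω 0 ≤ γ}.indicator fun _ => (1 : ℝ)) n ω = countLE γ ω n := by
  simp [birkhoffSum, countLE, indicator_apply, iterate_shift_apply]

theorem stmt8 (Ω₀ : Set ℝ) (hΩ₀sub : Ω₀ ⊆ Ioo (0:ℝ) 1) (hΩ₀int : Ω₀.OrdConnected)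
    (γstar : ℝ) (hstar : γstar < 1) (hub : ∀ x ∈ Ω₀, x ≤ γstar)
    (P : Measure (ℕ → ℝ)) (hP : IsProbabilityMeasure P)
    (hsupp : P {ω | ∀ n, ω n ∈ Ω₀} = 1)
    (γ : ℝ) (hγ : γ ∈ Ω₀)
    (hA1 : MeasurePreserving shift P P)
    (hA2 : Ergodic shift P)
    (hA3 : 0 < P {ω | ω 0 ≤ γ}) :
    ∀ᵐ ω ∂P,
      (∀ aβ : ℝ, 2 ^ γ * (γ + 2) < aβ →
        ∀ μ ν : Measure ℝ, IsProbabilityMeasure μ → IsProbabilityMeasure ν →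
          HolderDensityOn (Icc (0:ℝ) 1) μ → ConeDensity γ aβ ν →
          ∃ C : ℝ, ∀ n : ℕ, 1 ≤ n →
            tvDist (Measure.map (lsvComp ω n) μ) (Measure.map (lsvComp ω n) ν) ≤
              C * (n : ℝ) ^ (-1 / γ + 1)) ∧
      (∀ μ μ' : Measure ℝ, IsProbabilityMeasure μ → IsProbabilityMeasure μ' →
        HolderDensityOn (Icc (0:ℝ) 1) μ → HolderDensityOn (Icc (0:ℝ) 1) μ' →
        ∃ C : ℝ, ∀ n : ℕ, 1 ≤ n →
          tvDist (Measure.map (lsvComp ω n) μ) (Measure.map (lsvComp ω n) μ') ≤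
            C * (n : ℝ) ^ (-1 / γ)) := by
  have hmem : ∀ᵐ ω ∂P, ∀ n, ω n ∈ Ω₀ := by
    refine (mem_ae_iff_prob_eq_one ?_).2 hsupp
    rw [ofPred_forall]
    exact MeasurableSet.iInter fun n => hΩ₀int.measurableSet.preimage (measurable_pi_apply n)
  have hE : MeasurableSet {ω : ℕ → ℝ | ω 0 ≤ γ} :=
    measurableSet_le (measurable_pi_apply 0) measurable_const
  obtain ⟨c, hc, hvisits⟩ := hA2.ae_le_card_visits hE hA3
  filter_upwards [hmem, hvisits] with ω hω ⟨C₀, hC₀⟩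
  have hω0 : ∀ i, 0 < ω i := fun i => (hΩ₀sub (hω i)).1
  have hωγ : ∀ i, ω i ≤ γstar := fun i => hub _ (hω i)
  have hγ0 : 0 < γ := (hΩ₀sub hγ).1
  have hcount : ∀ n : ℕ, c * n - C₀ ≤ countLE γ ω n := fun n =>
    (hC₀ n).trans_eq (birkhoffSum_shift γ ω n)
  refine ⟨fun aβ haβ μ ν _ _ hμ hν => ?_, fun μ μ' _ _ hμ hμ' => ?_⟩
  · exact exists_tvDist_le_of_cone hω0 hωγ hstar hγ0 (hub γ hγ) hc hcount
      (le_trans (by positivity) haβ.le) hμ hν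
  · exact exists_tvDist_le_of_holder hω0 hωγ hstar hγ0 (hub γ hγ) hc hcount hμ hμ'

end
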